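/- Let K = ℚ(√-11), let u = √-11 ∈ K, and let σ be the nontrivial automorphism of K over ℚ. In K(t)[x] (t the generator of the rational function field), set f_D(t,x) = -11^2·u·(1188u·x^3 + 198u·x^2 - 1346u·x - 27u + 594x^4 - 7920x^2 - 1474x + 135)^3 - 2^8·3^13·(253u - 67)·t·x, and let f_{D2}(t,x) = f_D(t,x)·(σf_D)(t,x), where σf_D is obtained by applying σ to all coefficients. Then f_{D2} has all coefficients in ℚ(t), and the Galois group of f_{D2} over ℚ(t) has cardinality 190080 (the order of the group M₁₂.2 = Aut(M₁₂)). -/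

import Mathlib

open Polynomial

section PermGroup

variable {Ω : Type*} {G : Subgroup (Equiv.Perm Ω)}

/-- The stabilizer of a point in a permutation group. -/
def pointStab (H : Subgroup (Equiv.Perm Ω)) (x : Ω) : Subgroup (Equiv.Perm Ω) :=
  H ⊓ MulAction.stabilizer (Equiv.Perm Ω) x

theorem mem_pointStab {H : Subgroup (Equiv.Perm Ω)} {x : Ω} {g : Equiv.Perm Ω} :
    g ∈ pointStab H x ↔ g ∈ H ∧ g x = x := by
  simp [pointStab, Subgroup.mem_inf, MulAction.mem_stabilizer_iff]

theorem mem_pointStab_pair {a b : Ω} {g : Equiv.Perm Ω} :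
    g ∈ pointStab (pointStab G a) b ↔ g ∈ G ∧ g a = a ∧ g b = b := by
  rw [mem_pointStab, mem_pointStab, and_assoc]

theorem mem_pointStab_triple {a b c : Ω} {g : Equiv.Perm Ω} :
    g ∈ pointStab (pointStab (pointStab G a) b) c ↔ g ∈ G ∧ g a = a ∧ g b = b ∧ g c = c := by
  rw [mem_pointStab, mem_pointStab_pair, and_assoc, and_assoc]

theorem conj_apply_eq_iff {f g : Equiv.Perm Ω} {x : Ω} :
    (g * f * g⁻¹) x = x ↔ f (g⁻¹ x) = g⁻¹ x := by
  simp only [Equiv.Perm.mul_apply]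
  constructor
  · intro h
    conv_rhs => rw [← h]
    simp
  · intro h
    rw [h]; simp

theorem conj_pow_eq_one {f g : Equiv.Perm Ω} {n : ℕ} (hf : f ^ n = 1) : (g * f * g⁻¹) ^ n = 1 := by
  rw [conj_pow, hf]; simp

theorem conj_mem {f g : Equiv.Perm Ω} (hf : f ∈ G) (hg : g ∈ G) : g * f * g⁻¹ ∈ G :=
  G.mul_mem (G.mul_mem hg hf) (G.inv_mem hg)

theorem exists_map_pair (h1 : ∀ a b, ∃ g ∈ G, g a = b) (a : Ω)
    (h2 : ∀ b c, b ≠ a → c ≠ a → ∃ g ∈ G, g a = a ∧ g b = c) :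
    ∀ a b a' b', a ≠ b → a' ≠ b' → ∃ g ∈ G, g a = a' ∧ g b = b' := by
  intro x y x' y' hxy hxy'
  obtain ⟨g, hg, hgx⟩ := h1 x a
  obtain ⟨g', hg', hgx'⟩ := h1 x' a
  obtain ⟨k, hk, hka, hkb⟩ := h2 (g y) (g' y')
    (fun h => hxy (g.injective (hgx.trans h.symm)))
    (fun h => hxy' (g'.injective (hgx'.trans h.symm)))
  refine ⟨g'⁻¹ * k * g, G.mul_mem (G.mul_mem (G.inv_mem hg') hk) hg, ?_, ?_⟩
  · rw [Equiv.Perm.mul_apply, Equiv.Perm.mul_apply, hgx, hka, ← hgx']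
    exact g'.symm_apply_apply _
  · simp [hkb]

theorem exists_map_triple
    (h2 : ∀ a b a' b', a ≠ b → a' ≠ b' → ∃ g ∈ G, g a = a' ∧ g b = b') (a b : Ω) (hab : a ≠ b)
    (h3 : ∀ c d, c ≠ a → c ≠ b → d ≠ a → d ≠ b → ∃ g ∈ G, g a = a ∧ g b = b ∧ g c = d) :
    ∀ a b c a' b' c', a ≠ b → a ≠ c → b ≠ c → a' ≠ b' → a' ≠ c' → b' ≠ c' →
      ∃ g ∈ G, g a = a' ∧ g b = b' ∧ g c = c' := by
  intro x y z x' y' z' hxy hxz hyz hxy' hxz' hyz'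
  obtain ⟨g, hg, hgx, hgy⟩ := h2 x y a b hxy hab
  obtain ⟨g', hg', hgx', hgy'⟩ := h2 x' y' a b hxy' hab
  obtain ⟨k, hk, hka, hkb, hkc⟩ := h3 (g z) (g' z')
    (fun h => hxz (g.injective (hgx.trans h.symm)))
    (fun h => hyz (g.injective (hgy.trans h.symm)))
    (fun h => hxz' (g'.injective (hgx'.trans h.symm)))
    (fun h => hyz' (g'.injective (hgy'.trans h.symm)))
  refine ⟨g'⁻¹ * k * g, G.mul_mem (G.mul_mem (G.inv_mem hg') hk) hg, ?_, ?_, ?_⟩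
  · rw [Equiv.Perm.mul_apply, Equiv.Perm.mul_apply, hgx, hka, ← hgx']
    exact g'.symm_apply_apply _
  · rw [Equiv.Perm.mul_apply, Equiv.Perm.mul_apply, hgy, hkb, ← hgy']
    exact g'.symm_apply_apply _
  · simp [hkc]

variable [Fintype Ω] [DecidableEq Ω]

/-- The fixed points of a permutation, as a finset. -/
def fixedFinset (f : Equiv.Perm Ω) : Finset Ω := Finset.univ.filter fun x => f x = x

/-- The orbit of a point under a permutation group, as a finset. -/
noncomputable def orbitFinset (H : Subgroup (Equiv.Perm Ω)) (x : Ω) : Finset Ω :=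
  open Classical in
  Finset.univ.filter fun y => ∃ h ∈ H, h x = y

theorem mem_orbitFinset {H : Subgroup (Equiv.Perm Ω)} {x y : Ω} :
    y ∈ orbitFinset H x ↔ ∃ h ∈ H, h x = y := by
  classical simp [orbitFinset]

theorem card_eq_orbit_mul_stab (H : Subgroup (Equiv.Perm Ω)) (x : Ω) :
    Nat.card H = (orbitFinset H x).card * Nat.card (pointStab H x) := by
  have h1 := Subgroup.card_mul_index (MulAction.stabilizer H x)
  rw [MulAction.index_stabilizer] at h1
  have h2 : MulAction.orbit H x = (orbitFinset H x : Set Ω) := by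
    ext y
    simp only [MulAction.mem_orbit_iff, Finset.mem_coe, mem_orbitFinset, Subtype.exists]
    constructor
    · rintro ⟨a, ha, h⟩; exact ⟨a, ha, h⟩
    · rintro ⟨a, ha, h⟩; exact ⟨a, ha, h⟩
  have h3 : Nat.card (MulAction.stabilizer H x) = Nat.card (pointStab H x) := by
    refine Nat.card_congr
      { toFun := fun g => ⟨g.1.1, mem_pointStab.2 ⟨g.1.2, g.2⟩⟩
        invFun := fun g => ⟨⟨g.1, (mem_pointStab.1 g.2).1⟩, (mem_pointStab.1 g.2).2⟩
        left_inv := fun _ => rfl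
        right_inv := fun _ => rfl }
  rw [h2, Set.ncard_coe_finset, h3] at h1
  rw [← h1, mul_comm]

theorem orbitFinset_invariant {H : Subgroup (Equiv.Perm Ω)} {g : Equiv.Perm Ω} (hg : g ∈ H)
    (x : Ω) : ∀ y ∈ orbitFinset H x, g y ∈ orbitFinset H x := by
  intro y hy
  obtain ⟨h, hh, rfl⟩ := mem_orbitFinset.1 hy
  exact mem_orbitFinset.2 ⟨g * h, H.mul_mem hg hh, rfl⟩

theorem self_mem_orbitFinset (H : Subgroup (Equiv.Perm Ω)) (x : Ω) : x ∈ orbitFinset H x :=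
  mem_orbitFinset.2 ⟨1, H.one_mem, rfl⟩

theorem card_modEq_card_fixed {f : Equiv.Perm Ω} {S : Finset Ω} (hS : ∀ x ∈ S, f x ∈ S)
    {p n : ℕ} (hp : p.Prime) (hf : f ^ p ^ n = 1) :
    S.card ≡ (S ∩ fixedFinset f).card [MOD p] := by
  have := Fact.mk hp
  let F : Function.End S := fun x => ⟨f x, hS x x.2⟩
  have hF : ∀ m : ℕ, ∀ x : S, ((F ^ m) x : Ω) = (f ^ m) x := by
    intro m
    induction m with
    | zero => intro x; rfl
    | succ m ih => intro x; rw [pow_succ, pow_succ]; exact ih (F x)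
  have h1 : F ^ p ^ n = 1 := by
    funext x
    apply Subtype.ext
    rw [hF, hf]; rfl
  have h2 := Equiv.Perm.card_fixedPoints_modEq h1
  rw [Fintype.card_coe] at h2
  have h3 : Fintype.card (Function.fixedPoints F) = (S ∩ fixedFinset f).card := by
    rw [← Fintype.card_coe]
    refine Fintype.card_congr
      { toFun := fun x => ⟨x.1.1, Finset.mem_inter.2 ⟨x.1.2, ?_⟩⟩
        invFun := fun x => ⟨⟨x.1, (Finset.mem_inter.1 x.2).1⟩, ?_⟩
        left_inv := fun _ => rfl
        right_inv := fun _ => rfl }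
    · have := x.2
      have h4 : F x.1 = x.1 := this
      exact Finset.mem_filter.2 ⟨Finset.mem_univ _, congrArg Subtype.val h4⟩
    · have := (Finset.mem_inter.1 x.2).2
      simp only [fixedFinset, Finset.mem_filter] at this
      exact Subtype.ext this.2
  rwa [h3] at h2

theorem mem_fixedFinset {f : Equiv.Perm Ω} {x : Ω} : x ∈ fixedFinset f ↔ f x = x := by
  simp [fixedFinset]

theorem card_orbitFinset_modEq {H : Subgroup (Equiv.Perm Ω)} {f : Equiv.Perm Ω} (hf : f ∈ H) (x : Ω)
    {p n : ℕ} (hp : p.Prime) (hfp : f ^ p ^ n = 1) :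
    (orbitFinset H x).card ≡ (orbitFinset H x ∩ fixedFinset f).card [MOD p] :=
  card_modEq_card_fixed (orbitFinset_invariant hf x) hp hfp


theorem card_pos_orbitFinset (H : Subgroup (Equiv.Perm Ω)) (x : Ω) : 0 < (orbitFinset H x).card :=
  Finset.card_pos.2 ⟨x, self_mem_orbitFinset H x⟩

theorem fixedFinset_conj (f g : Equiv.Perm Ω) :
    fixedFinset (g * f * g⁻¹) = (fixedFinset f).image g := by
  ext x
  rw [mem_fixedFinset, conj_apply_eq_iff, Finset.mem_image]
  constructor
  · intro h; exact ⟨g⁻¹ x, mem_fixedFinset.2 h, by simp⟩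
  · rintro ⟨y, hy, rfl⟩
    simpa using mem_fixedFinset.1 hy

theorem orbitFinset_subset_fixed {H : Subgroup (Equiv.Perm Ω)} {a x : Ω} (hH : ∀ g ∈ H, g a = a)
    (hx : x ≠ a) : a ∉ orbitFinset H x := by
  intro h
  obtain ⟨g, hg, hgx⟩ := mem_orbitFinset.1 h
  exact hx (g.injective (hgx.trans (hH g hg).symm))

theorem exists_of_orbitFinset_eq {H : Subgroup (Equiv.Perm Ω)} {S : Finset Ω} {b c d : Ω}
    (h : orbitFinset H b = S) (hc : c ∈ S) (hd : d ∈ S) : ∃ g ∈ H, g c = d := by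
  rw [← h] at hc hd
  obtain ⟨g, hg, rfl⟩ := mem_orbitFinset.1 hc
  obtain ⟨k, hk, rfl⟩ := mem_orbitFinset.1 hd
  exact ⟨k * g⁻¹, H.mul_mem hk (H.inv_mem hg), by simp⟩

/-- A group of order `360` with an element of order `8` has a subgroup of order `45` containing every
element of odd order. -/
theorem exists_odd_complement {H : Type*} [Group H] [Finite H] (hH : Nat.card H = 360)
    (x : H) (hx : orderOf x = 8) :
    ∃ M : Subgroup H, Nat.card M = 45 ∧ ∀ (y : H) (m : ℕ), m.Coprime 8 → y ^ m = 1 → y ∈ M := by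
  have := Fact.mk Nat.prime_two
  have hP : Nat.card (Subgroup.zpowers x) = 8 := by rw [Nat.card_zpowers, hx]
  have hidx : (Subgroup.zpowers x).index = 45 := by
    have := Subgroup.card_mul_index (Subgroup.zpowers x)
    rw [hP, hH] at this
    omega
  have hpg : IsPGroup 2 (Subgroup.zpowers x) := IsPGroup.of_card (n := 3) (by rw [hP]; norm_num)
  let P : Sylow 2 H := hpg.toSylow (by rw [hidx]; norm_num)
  have hPc : IsCyclic (P : Subgroup H) := by
    change IsCyclic (Subgroup.zpowers x)
    infer_instance
  have hmf : (Nat.card H).minFac = 2 := by rw [hH]; norm_num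
  have hc := IsCyclic.isComplement' hmf hPc
  refine ⟨(MonoidHom.transferSylow P (hPc.normalizer_le_centralizer hmf)).ker, ?_, ?_⟩
  · have h1 := hc.card_mul_card
    have h2 : Nat.card (P : Subgroup H) = 8 := hP
    rw [h2, hH] at h1
    omega
  · intro y m hm hy
    rw [MonoidHom.mem_ker]
    set z := MonoidHom.transferSylow P (hPc.normalizer_le_centralizer hmf) y with hz
    have h1 : z ^ m = 1 := by rw [hz, ← map_pow, hy, map_one]
    have h2 : z ^ 8 = 1 := by
      have h3 : Nat.card (P : Subgroup H) = 8 := hP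
      rw [← h3]; exact pow_card_eq_one'
    have h4 : orderOf z ∣ Nat.gcd m 8 := Nat.dvd_gcd (orderOf_dvd_of_pow_eq_one h1)
      (orderOf_dvd_of_pow_eq_one h2)
    rw [hm] at h4
    exact orderOf_eq_one_iff.1 (Nat.dvd_one.1 h4)


theorem orbitFinset_eq_of_card_le {H : Subgroup (Equiv.Perm Ω)} {S : Finset Ω} {x : Ω}
    (hS : orbitFinset H x ⊆ S) (h : S.card ≤ (orbitFinset H x).card) : orbitFinset H x = S :=
  Finset.eq_of_subset_of_card_le hS h

theorem card_inter_eq_zero {S F : Finset Ω} (h : ∀ x ∈ F, x ∉ S) : (S ∩ F).card = 0 := by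
  rw [Finset.card_eq_zero, Finset.eq_empty_iff_forall_notMem]
  intro x hx
  exact h x (Finset.mem_inter.1 hx).2 (Finset.mem_inter.1 hx).1

theorem transitive_of_cycles (hΩ : Fintype.card Ω = 12) {g11 g10 : Equiv.Perm Ω}
    (h11 : g11 ∈ G) (h11p : g11 ^ 11 = 1) (h11f : (fixedFinset g11).card = 1)
    (h10 : g10 ∈ G) (h10f : (fixedFinset g10).card = 0) :
    ∀ a b, ∃ g ∈ G, g a = b := by
  obtain ⟨a, ha⟩ := Finset.card_eq_one.1 h11f
  have h1 := card_orbitFinset_modEq (n := 1) h11 a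
    (by norm_num : Nat.Prime 11) (by simpa using h11p)
  rw [ha, Finset.inter_singleton_of_mem (self_mem_orbitFinset G a), Finset.card_singleton] at h1
  have h2 : 1 < (orbitFinset G a).card := by
    rw [Finset.one_lt_card]
    refine ⟨a, self_mem_orbitFinset G a, g10 a, mem_orbitFinset.2 ⟨g10, h10, rfl⟩, ?_⟩
    intro h
    have : a ∈ fixedFinset g10 := mem_fixedFinset.2 h.symm
    rw [Finset.card_eq_zero.1 h10f] at this
    simp at this
  have h3 : (orbitFinset G a).card ≤ 12 := by rw [← hΩ]; exact Finset.card_le_univ _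
  have h4 : orbitFinset G a = Finset.univ := by
    apply orbitFinset_eq_of_card_le (Finset.subset_univ _)
    rw [Finset.card_univ, hΩ]
    rw [Nat.ModEq] at h1
    omega
  intro x y
  exact exists_of_orbitFinset_eq h4 (Finset.mem_univ x) (Finset.mem_univ y)

theorem two_transitive_of_cycles (hΩ : Fintype.card Ω = 12) {g11 : Equiv.Perm Ω}
    (h1 : ∀ a b, ∃ g ∈ G, g a = b)
    (h11 : g11 ∈ G) (h11p : g11 ^ 11 = 1) (h11f : (fixedFinset g11).card = 1) :
    ∀ a b a' b', a ≠ b → a' ≠ b' → ∃ g ∈ G, g a = a' ∧ g b = b' := by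
  obtain ⟨a, ha⟩ := Finset.card_eq_one.1 h11f
  have ha' : g11 a = a := mem_fixedFinset.1 (ha ▸ Finset.mem_singleton_self a)
  refine exists_map_pair h1 a fun b c hb hc => ?_
  have hm : g11 ∈ pointStab G a := mem_pointStab.2 ⟨h11, ha'⟩
  have h2 := card_orbitFinset_modEq (n := 1) hm b (by norm_num : Nat.Prime 11) (by simpa using h11p)
  have haO : a ∉ orbitFinset (pointStab G a) b :=
    orbitFinset_subset_fixed (fun g hg => (mem_pointStab.1 hg).2) hb
  rw [card_inter_eq_zero (by rw [ha]; simpa using haO)] at h2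
  have h3 := card_pos_orbitFinset (pointStab G a) b
  have h4 : orbitFinset (pointStab G a) b = Finset.univ.erase a := by
    apply orbitFinset_eq_of_card_le
    · intro x hx
      exact Finset.mem_erase.2 ⟨fun h => haO (h ▸ hx), Finset.mem_univ _⟩
    · rw [Finset.card_erase_of_mem (Finset.mem_univ _), Finset.card_univ, hΩ]
      rw [Nat.ModEq] at h2
      omega
  obtain ⟨g, hg, hgc⟩ := exists_of_orbitFinset_eq (c := b) (d := c) h4 (by simpa using hb)
    (by simpa using hc)
  exact ⟨g, (mem_pointStab.1 hg).1, (mem_pointStab.1 hg).2, hgc⟩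

theorem exists_conj_fixed_pair (h2 : ∀ a b a' b', a ≠ b → a' ≠ b' → ∃ g ∈ G, g a = a' ∧ g b = b')
    {f : Equiv.Perm Ω} (hf : f ∈ G) {n : ℕ} (hfn : f ^ n = 1) (hfc : (fixedFinset f).card = 2)
    {a b : Ω} (hab : a ≠ b) : ∃ f' ∈ G, f' ^ n = 1 ∧ fixedFinset f' = {a, b} := by
  obtain ⟨x, y, hxy, hF⟩ := Finset.card_eq_two.1 hfc
  obtain ⟨g, hg, rfl, rfl⟩ := h2 x y a b hxy hab
  exact ⟨g * f * g⁻¹, conj_mem hf hg, conj_pow_eq_one hfn, by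
    rw [fixedFinset_conj, hF, Finset.image_insert, Finset.image_singleton]⟩

theorem three_transitive_of_cycles (hΩ : Fintype.card Ω = 12) {g10 g8 : Equiv.Perm Ω}
    (h2 : ∀ a b a' b', a ≠ b → a' ≠ b' → ∃ g ∈ G, g a = a' ∧ g b = b')
    (h10 : g10 ∈ G) (h10p : g10 ^ 10 = 1) (h10f : (fixedFinset (g10 ^ 2)).card = 2)
    (h8 : g8 ∈ G) (h8p : g8 ^ 8 = 1) (h8f : (fixedFinset g8).card = 2) :
    ∀ a b c a' b' c', a ≠ b → a ≠ c → b ≠ c → a' ≠ b' → a' ≠ c' → b' ≠ c' →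
      ∃ g ∈ G, g a = a' ∧ g b = b' ∧ g c = c' := by
  obtain ⟨a, b, hab, hF⟩ := Finset.card_eq_two.1 h8f
  have ha8 : g8 a = a := mem_fixedFinset.1 (by rw [hF]; simp)
  have hb8 : g8 b = b := mem_fixedFinset.1 (by rw [hF]; simp)
  obtain ⟨f, hf, hf5, hfF⟩ := exists_conj_fixed_pair h2 (G.pow_mem h10 2) (n := 5)
    (by rw [← pow_mul]; exact h10p) h10f hab
  have haf : f a = a := mem_fixedFinset.1 (by rw [hfF]; simp)
  have hbf : f b = b := mem_fixedFinset.1 (by rw [hfF]; simp)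
  refine exists_map_triple h2 a b hab fun c d hca hcb hda hdb => ?_
  set H := pointStab (pointStab G a) b with hH
  have haO : a ∉ orbitFinset H c :=
    orbitFinset_subset_fixed (fun g hg => (mem_pointStab_pair.1 hg).2.1) hca
  have hbO : b ∉ orbitFinset H c :=
    orbitFinset_subset_fixed (fun g hg => (mem_pointStab_pair.1 hg).2.2) hcb
  have e : ∀ x ∈ ({a, b} : Finset Ω), x ∉ orbitFinset H c := by
    intro x hx
    rw [Finset.mem_insert, Finset.mem_singleton] at hx
    rcases hx with rfl | rfl
    exacts [haO, hbO]
  have m2 := card_orbitFinset_modEq (H := H) (p := 2) (n := 3)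
    (mem_pointStab_pair.2 ⟨h8, ha8, hb8⟩) c Nat.prime_two (by simpa using h8p)
  have m5 := card_orbitFinset_modEq (H := H) (p := 5) (n := 1)
    (mem_pointStab_pair.2 ⟨hf, haf, hbf⟩) c Nat.prime_five (by simpa using hf5)
  rw [card_inter_eq_zero (by rw [hF]; exact e)] at m2
  rw [card_inter_eq_zero (by rw [hfF]; exact e)] at m5
  have h3 := card_pos_orbitFinset H c
  have h4 : orbitFinset H c = Finset.univ \ {a, b} := by
    apply orbitFinset_eq_of_card_le
    · intro x hx
      exact Finset.mem_sdiff.2 ⟨Finset.mem_univ _, fun h => e x h hx⟩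
    · rw [Finset.card_sdiff_of_subset (Finset.subset_univ _), Finset.card_univ, hΩ,
        Finset.card_pair hab]
      rw [Nat.ModEq] at m2 m5
      omega
  obtain ⟨g, hg, hgc⟩ := exists_of_orbitFinset_eq (c := c) (d := d) h4
    (by simp [hca, hcb]) (by simp [hda, hdb])
  exact ⟨g, (mem_pointStab_pair.1 hg).1, (mem_pointStab_pair.1 hg).2.1,
    (mem_pointStab_pair.1 hg).2.2, hgc⟩

theorem card_fourth_orbit (hΩ : Fintype.card Ω = 12) {g8 g6 : Equiv.Perm Ω}
    (h3 : ∀ a b c a' b' c', a ≠ b → a ≠ c → b ≠ c → a' ≠ b' → a' ≠ c' → b' ≠ c' →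
      ∃ g ∈ G, g a = a' ∧ g b = b' ∧ g c = c')
    (h8 : g8 ∈ G) (h8p : g8 ^ 8 = 1) (h8f2 : (fixedFinset (g8 ^ 2)).card = 4)
    (h8f4 : (fixedFinset (g8 ^ 4)).card = 4)
    (h6 : g6 ∈ G) (h6p : g6 ^ 6 = 1) (h6f : (fixedFinset (g6 ^ 2)).card = 3) :
    ∃ a b c d, a ≠ b ∧ a ≠ c ∧ b ≠ c ∧
      (orbitFinset (pointStab (pointStab (pointStab G a) b) c) d).card = 9 := by
  obtain ⟨a, b, c, hab, hac, hbc, hF6⟩ := Finset.card_eq_three.1 h6f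
  obtain ⟨p, q, r, s, hpq, hpr, hps, hqr, hqs, hrs, hF8⟩ := Finset.card_eq_four.1 h8f2
  obtain ⟨g, hg, hga, hgb, hgc⟩ := h3 p q r a b c hpq hpr hqr hab hac hbc
  set f := g * g8 ^ 2 * g⁻¹ with hf
  have hfG : f ∈ G := conj_mem (G.pow_mem h8 2) hg
  have hfp : f ^ 4 = 1 := conj_pow_eq_one (by rw [← pow_mul]; exact h8p)
  have hfF : fixedFinset f = {a, b, c, g s} := by
    rw [hf, fixedFinset_conj, hF8]
    simp only [Finset.image_insert, Finset.image_singleton, hga, hgb, hgc]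
  have hf2 : f ^ 2 = g * g8 ^ 4 * g⁻¹ := by rw [hf, conj_pow, ← pow_mul]
  have hfF2 : fixedFinset (f ^ 2) = fixedFinset f := by
    symm
    apply Finset.eq_of_subset_of_card_le
    · intro x hx
      have := mem_fixedFinset.1 hx
      rw [mem_fixedFinset, pow_two, Equiv.Perm.mul_apply, this, this]
    · rw [hf2, hf, fixedFinset_conj, fixedFinset_conj, Finset.card_image_of_injective _ g.injective,
        Finset.card_image_of_injective _ g.injective, h8f2, h8f4]
  have hsa : g s ≠ a := fun h => hps (g.injective (hga.trans h.symm))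
  have hsb : g s ≠ b := fun h => hqs (g.injective (hgb.trans h.symm))
  have hsc : g s ≠ c := fun h => hrs (g.injective (hgc.trans h.symm))
  refine ⟨a, b, c, g s, hab, hac, hbc, ?_⟩
  set d := g s with hd
  set H := pointStab (pointStab (pointStab G a) b) c with hH
  have fx : ∀ x ∈ ({a, b, c, d} : Finset Ω), f x = x := fun x hx =>
    mem_fixedFinset.1 (by rw [hfF]; exact hx)
  have fx6 : ∀ x ∈ ({a, b, c} : Finset Ω), (g6 ^ 2) x = x := fun x hx =>
    mem_fixedFinset.1 (by rw [hF6]; exact hx)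
  have hfH : f ∈ H := mem_pointStab_triple.2
    ⟨hfG, fx a (by simp), fx b (by simp), fx c (by simp)⟩
  have h6H : g6 ^ 2 ∈ H := mem_pointStab_triple.2
    ⟨G.pow_mem h6 2, fx6 a (by simp), fx6 b (by simp), fx6 c (by simp)⟩
  have haO : a ∉ orbitFinset H d :=
    orbitFinset_subset_fixed (fun g hg => (mem_pointStab_triple.1 hg).2.1) hsa
  have hbO : b ∉ orbitFinset H d :=
    orbitFinset_subset_fixed (fun g hg => (mem_pointStab_triple.1 hg).2.2.1) hsb
  have hcO : c ∉ orbitFinset H d :=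
    orbitFinset_subset_fixed (fun g hg => (mem_pointStab_triple.1 hg).2.2.2) hsc
  have e : ∀ x ∈ ({a, b, c} : Finset Ω), x ∉ orbitFinset H d := by
    intro x hx
    simp only [Finset.mem_insert, Finset.mem_singleton] at hx
    rcases hx with rfl | rfl | rfl
    exacts [haO, hbO, hcO]
  have hdO := self_mem_orbitFinset H d
  have m3 := card_orbitFinset_modEq (p := 3) (n := 1) h6H d Nat.prime_three
    (by rw [pow_one, ← pow_mul]; exact h6p)
  rw [card_inter_eq_zero (by rw [hF6]; exact e)] at m3
  have m2 := card_orbitFinset_modEq (p := 2) (n := 2) hfH d Nat.prime_two (by simpa using hfp)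
  have hI : orbitFinset H d ∩ fixedFinset f = {d} := by
    rw [hfF]
    ext x
    simp only [Finset.mem_inter, Finset.mem_insert, Finset.mem_singleton]
    constructor
    · rintro ⟨hx, rfl | rfl | rfl | h⟩
      exacts [(haO hx).elim, (hbO hx).elim, (hcO hx).elim, h]
    · rintro rfl
      exact ⟨hdO, by simp⟩
  rw [hI, Finset.card_singleton] at m2
  have hle : (orbitFinset H d).card ≤ 9 := by
    have h1 : orbitFinset H d ⊆ Finset.univ \ {a, b, c} := fun x hx =>
      Finset.mem_sdiff.2 ⟨Finset.mem_univ _, fun h => e x h hx⟩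
    have h2 := Finset.card_le_card h1
    rw [Finset.card_sdiff_of_subset (Finset.subset_univ _), Finset.card_univ, hΩ,
      Finset.card_eq_three.2 ⟨a, b, c, hab, hac, hbc, rfl⟩] at h2
    exact h2
  have hne3 : (orbitFinset H d).card ≠ 3 := by
    intro h
    have h2 : ((orbitFinset H d).erase d).card = 2 := by
      rw [Finset.card_erase_of_mem hdO, h]
    obtain ⟨x, y, hxy, hE⟩ := Finset.card_eq_two.1 h2
    have hmem : ∀ z, z ∈ (orbitFinset H d).erase d → f z ∈ (orbitFinset H d).erase d := by
      intro z hz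
      refine Finset.mem_erase.2 ⟨fun h => (Finset.mem_erase.1 hz).1 ?_,
        orbitFinset_invariant hfH d z (Finset.mem_erase.1 hz).2⟩
      exact f.injective (h.trans (fx d (by simp)).symm)
    have hnf : ∀ z, z ∈ (orbitFinset H d).erase d → f z ≠ z := by
      intro z hz h
      have : z ∈ orbitFinset H d ∩ fixedFinset f :=
        Finset.mem_inter.2 ⟨(Finset.mem_erase.1 hz).2, mem_fixedFinset.2 h⟩
      rw [hI, Finset.mem_singleton] at this
      exact (Finset.mem_erase.1 hz).1 this
    rw [hE] at hmem hnf
    have hx := hmem x (by simp)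
    have hy := hmem y (by simp)
    have hx' := hnf x (by simp)
    have hy' := hnf y (by simp)
    simp only [Finset.mem_insert, Finset.mem_singleton] at hx hy
    have hfx : f x = y := hx.resolve_left hx'
    have hfy : f y = x := hy.resolve_right hy'
    have : x ∈ fixedFinset (f ^ 2) := by
      rw [mem_fixedFinset, pow_two, Equiv.Perm.mul_apply, hfx, hfy]
    rw [hfF2] at this
    exact hx' (mem_fixedFinset.1 this)
  have hpos := card_pos_orbitFinset H d
  rw [Nat.ModEq] at m2 m3
  omega

theorem card_orbitFinset_of_transitive (hΩ : Fintype.card Ω = 12) (h1 : ∀ a b, ∃ g ∈ G, g a = b)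
    (a : Ω) : (orbitFinset G a).card = 12 := by
  have : orbitFinset G a = Finset.univ :=
    Finset.eq_univ_iff_forall.2 fun b => mem_orbitFinset.2 (h1 a b)
  rw [this, Finset.card_univ, hΩ]

theorem card_orbitFinset_of_two_transitive (hΩ : Fintype.card Ω = 12)
    (h2 : ∀ a b a' b', a ≠ b → a' ≠ b' → ∃ g ∈ G, g a = a' ∧ g b = b') {a b : Ω} (hab : a ≠ b) :
    (orbitFinset (pointStab G a) b).card = 11 := by
  have : orbitFinset (pointStab G a) b = Finset.univ.erase a := by
    ext x
    rw [mem_orbitFinset, Finset.mem_erase]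
    constructor
    · rintro ⟨g, hg, rfl⟩
      refine ⟨fun h => hab ?_, Finset.mem_univ _⟩
      exact g.injective ((mem_pointStab.1 hg).2.trans h.symm)
    · rintro ⟨hx, -⟩
      obtain ⟨g, hg, hga, hgb⟩ := h2 a b a x hab hx.symm
      exact ⟨g, mem_pointStab.2 ⟨hg, hga⟩, hgb⟩
  rw [this, Finset.card_erase_of_mem (Finset.mem_univ _), Finset.card_univ, hΩ]

theorem card_orbitFinset_of_three_transitive (hΩ : Fintype.card Ω = 12)
    (h3 : ∀ a b c a' b' c', a ≠ b → a ≠ c → b ≠ c → a' ≠ b' → a' ≠ c' → b' ≠ c' →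
      ∃ g ∈ G, g a = a' ∧ g b = b' ∧ g c = c') {a b c : Ω} (hab : a ≠ b) (hac : a ≠ c)
    (hbc : b ≠ c) : (orbitFinset (pointStab (pointStab G a) b) c).card = 10 := by
  have : orbitFinset (pointStab (pointStab G a) b) c = Finset.univ \ {a, b} := by
    ext x
    rw [mem_orbitFinset, Finset.mem_sdiff, Finset.mem_insert, Finset.mem_singleton]
    constructor
    · rintro ⟨g, hg, rfl⟩
      rw [mem_pointStab_pair] at hg
      refine ⟨Finset.mem_univ _, ?_⟩
      rintro (h | h)
      · exact hac (g.injective (hg.2.1.trans h.symm))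
      · exact hbc (g.injective (hg.2.2.trans h.symm))
    · rintro ⟨-, hx⟩
      push Not at hx
      obtain ⟨g, hg, hga, hgb, hgc⟩ := h3 a b c a b x hab hac hbc hab hx.1.symm hx.2.symm
      exact ⟨g, mem_pointStab_pair.2 ⟨hg, hga, hgb⟩, hgc⟩
  rw [this, Finset.card_sdiff_of_subset (Finset.subset_univ _), Finset.card_univ, hΩ,
    Finset.card_pair hab]

theorem card_pair_stab_ne (hΩ : Fintype.card Ω = 12)
    {g10 g8 g6 : Equiv.Perm Ω}
    (h2 : ∀ a b a' b', a ≠ b → a' ≠ b' → ∃ g ∈ G, g a = a' ∧ g b = b')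
    (h10 : g10 ∈ G) (h10p : g10 ^ 10 = 1) (h10f : (fixedFinset (g10 ^ 2)).card = 2)
    (h6 : g6 ∈ G) (h6p : g6 ^ 6 = 1) (h6f : (fixedFinset (g6 ^ 2)).card = 3)
    {a b : Ω} (hab : a ≠ b) (h8 : g8 ∈ pointStab (pointStab G a) b) (h8o : orderOf g8 = 8) :
    Nat.card (pointStab (pointStab G a) b) ≠ 360 := by
  intro hcard
  set H := pointStab (pointStab G a) b with hH
  obtain ⟨M, hM, hMm⟩ := exists_odd_complement hcard ⟨g8, h8⟩
    (by rw [Subgroup.orderOf_mk]; exact h8o)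
  obtain ⟨f5, hf5, hf5p, hF5⟩ := exists_conj_fixed_pair h2 (G.pow_mem h10 2) (n := 5)
    (by rw [← pow_mul]; exact h10p) h10f hab
  obtain ⟨p, q, r, hpq, hpr, hqr, hF6⟩ := Finset.card_eq_three.1 h6f
  obtain ⟨g, hg, hga, hgb⟩ := h2 p q a b hpq hab
  set f3 := g * g6 ^ 2 * g⁻¹ with hf3
  have hf3p : f3 ^ 3 = 1 := conj_pow_eq_one (by rw [← pow_mul]; exact h6p)
  have hF3 : fixedFinset f3 = {a, b, g r} := by
    rw [hf3, fixedFinset_conj, hF6]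
    simp only [Finset.image_insert, Finset.image_singleton, hga, hgb]
  have hra : g r ≠ a := fun h => hpr (g.injective (hga.trans h.symm))
  have hrb : g r ≠ b := fun h => hqr (g.injective (hgb.trans h.symm))
  have h5H : f5 ∈ H := mem_pointStab_pair.2
    ⟨hf5, mem_fixedFinset.1 (by rw [hF5]; simp), mem_fixedFinset.1 (by rw [hF5]; simp)⟩
  have h3H : f3 ∈ H := mem_pointStab_pair.2
    ⟨conj_mem (G.pow_mem h6 2) hg, mem_fixedFinset.1 (by rw [hF3]; simp),
      mem_fixedFinset.1 (by rw [hF3]; simp)⟩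
  set M' := M.map H.subtype with hM'
  have hM'H : ∀ x ∈ M', x ∈ H := by
    rintro _ ⟨x, -, rfl⟩
    exact x.2
  have h5M : f5 ∈ M' := ⟨⟨f5, h5H⟩, hMm _ 5 (by norm_num) (Subtype.ext hf5p), rfl⟩
  have h3M : f3 ∈ M' := ⟨⟨f3, h3H⟩, hMm _ 3 (by norm_num) (Subtype.ext hf3p), rfl⟩
  have hcM : Nat.card M' = 45 := by
    rw [← hM]
    exact Nat.card_congr (M.equivMapOfInjective _ H.subtype_injective).symm.toEquiv
  have haO : a ∉ orbitFinset M' (g r) :=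
    orbitFinset_subset_fixed (fun g hg => (mem_pointStab_pair.1 (hM'H g hg)).2.1) hra
  have hbO : b ∉ orbitFinset M' (g r) :=
    orbitFinset_subset_fixed (fun g hg => (mem_pointStab_pair.1 (hM'H g hg)).2.2) hrb
  have m3 := card_orbitFinset_modEq (p := 3) (n := 1) h3M (g r) Nat.prime_three
    (by simpa using hf3p)
  have m5 := card_orbitFinset_modEq (p := 5) (n := 1) h5M (g r) Nat.prime_five
    (by simpa using hf5p)
  have hI : orbitFinset M' (g r) ∩ fixedFinset f3 = {g r} := by
    rw [hF3]
    ext x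
    simp only [Finset.mem_inter, Finset.mem_insert, Finset.mem_singleton]
    constructor
    · rintro ⟨hx, rfl | rfl | h⟩
      exacts [(haO hx).elim, (hbO hx).elim, h]
    · rintro rfl
      exact ⟨self_mem_orbitFinset _ _, by simp⟩
  rw [hI, Finset.card_singleton] at m3
  rw [card_inter_eq_zero (by
    rw [hF5]; intro x hx
    simp only [Finset.mem_insert, Finset.mem_singleton] at hx
    rcases hx with rfl | rfl
    exacts [haO, hbO])] at m5
  have hle : (orbitFinset M' (g r)).card ≤ 10 := by
    have h1 : orbitFinset M' (g r) ⊆ Finset.univ \ {a, b} := by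
      intro x hx
      refine Finset.mem_sdiff.2 ⟨Finset.mem_univ _, fun h => ?_⟩
      simp only [Finset.mem_insert, Finset.mem_singleton] at h
      rcases h with rfl | rfl
      exacts [haO hx, hbO hx]
    have h2 := Finset.card_le_card h1
    rwa [Finset.card_sdiff_of_subset (Finset.subset_univ _), Finset.card_univ, hΩ,
      Finset.card_pair hab] at h2
  have hdvd := card_eq_orbit_mul_stab M' (g r)
  rw [hcM] at hdvd
  have h10 : (orbitFinset M' (g r)).card = 10 := by
    have := card_pos_orbitFinset M' (g r)
    rw [Nat.ModEq] at m3 m5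
    omega
  rw [h10] at hdvd
  omega

/-- A permutation group of degree `12` and order at most `95040` containing elements of suitable
cycle types has order `95040`. -/
theorem card_eq_of_cycles (hΩ : Fintype.card Ω = 12) (hle : Nat.card G ≤ 95040)
    {g11 g10 g8 g6 : Equiv.Perm Ω}
    (h11 : g11 ∈ G) (h11p : g11 ^ 11 = 1) (h11f : (fixedFinset g11).card = 1)
    (h10 : g10 ∈ G) (h10p : g10 ^ 10 = 1) (h10f : (fixedFinset g10).card = 0)
    (h10f2 : (fixedFinset (g10 ^ 2)).card = 2)
    (h8 : g8 ∈ G) (h8p : g8 ^ 8 = 1) (h8f : (fixedFinset g8).card = 2)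
    (h8f2 : (fixedFinset (g8 ^ 2)).card = 4) (h8f4 : (fixedFinset (g8 ^ 4)).card = 4)
    (h6 : g6 ∈ G) (h6p : g6 ^ 6 = 1) (h6f : (fixedFinset (g6 ^ 2)).card = 3) :
    Nat.card G = 95040 := by
  have t1 := transitive_of_cycles hΩ h11 h11p h11f h10 h10f
  have t2 := two_transitive_of_cycles hΩ t1 h11 h11p h11f
  have t3 := three_transitive_of_cycles hΩ t2 h10 h10p h10f2 h8 h8p h8f
  obtain ⟨a, b, c, d, hab, hac, hbc, hd⟩ := card_fourth_orbit hΩ t3 h8 h8p h8f2 h8f4 h6 h6p h6f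
  have e1 := card_eq_orbit_mul_stab G a
  have e2 := card_eq_orbit_mul_stab (pointStab G a) b
  have e3 := card_eq_orbit_mul_stab (pointStab (pointStab G a) b) c
  have e4 := card_eq_orbit_mul_stab (pointStab (pointStab (pointStab G a) b) c) d
  rw [card_orbitFinset_of_transitive hΩ t1] at e1
  rw [card_orbitFinset_of_two_transitive hΩ t2 hab] at e2
  rw [card_orbitFinset_of_three_transitive hΩ t3 hab hac hbc] at e3
  rw [hd] at e4
  set s := Nat.card (pointStab (pointStab (pointStab (pointStab G a) b) c) d)
  obtain ⟨x, y, hxy, hF⟩ := Finset.card_eq_two.1 h8f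
  have f1 := card_eq_orbit_mul_stab G x
  have f2 := card_eq_orbit_mul_stab (pointStab G x) y
  rw [card_orbitFinset_of_transitive hΩ t1] at f1
  rw [card_orbitFinset_of_two_transitive hΩ t2 hxy] at f2
  have h8m : g8 ∈ pointStab (pointStab G x) y := mem_pointStab_pair.2
    ⟨h8, mem_fixedFinset.1 (by rw [hF]; simp), mem_fixedFinset.1 (by rw [hF]; simp)⟩
  have h8o : orderOf g8 = 8 := by
    refine orderOf_eq_prime_pow (p := 2) (n := 2) (x := g8) ?_ (by simpa using h8p)
    intro h
    rw [show 2 ^ 2 = 4 from rfl] at h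
    rw [h] at h8f4
    have : fixedFinset (1 : Equiv.Perm Ω) = Finset.univ := by
      ext z; simp [mem_fixedFinset]
    rw [this, Finset.card_univ, hΩ] at h8f4
    omega
  have hdvd : 8 ∣ Nat.card (pointStab (pointStab G x) y) := by
    have := orderOf_dvd_natCard (⟨g8, h8m⟩ : pointStab (pointStab G x) y)
    rwa [Subgroup.orderOf_mk, h8o] at this
  have hne := card_pair_stab_ne hΩ t2 h10 h10p h10f2 h6 h6p h6f hxy h8m h8o
  have hpos : 0 < Nat.card G := Nat.card_pos
  omega

end PermGroup

/-- The normalized Hadamard matrix of order `12` (as a Boolean matrix) preserved by `M₁₂`. -/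
def hadamard12 (i j : Fin 12) : Bool :=
  ([0, 2772, 3682, 1956, 1148, 2222, 3350, 2872, 498, 3528, 846, 1690].getD i.val 0 : ℕ).testBit
    j.val

theorem hadamard12_column_shift : ∀ v : Fin 12,
    (∀ j, ∃ w, ∀ i : Fin 12, i.val < 5 → hadamard12 i w = (hadamard12 i j ^^ hadamard12 i v)) →
      v = 0 := by
  decide +kernel

theorem hadamard12_column_eq : ∀ j w : Fin 12,
    (∀ i : Fin 12, i.val < 5 → hadamard12 i w = hadamard12 i j) → j ≠ 5 → j ≠ 10 → w = j := by
  decide +kernel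

theorem hadamard12_row_eq : ∀ k k' : Fin 12,
    (∀ j, j ≠ 5 → j ≠ 10 → hadamard12 k' j = hadamard12 k j) → k' = k := by
  decide +kernel

theorem hadamard12_column_injective : ∀ j w : Fin 12,
    (∀ i, hadamard12 i w = hadamard12 i j) → w = j := by
  decide +kernel

theorem hadamard12_zero_right : ∀ i : Fin 12, hadamard12 i 0 = false := by
  decide +kernel

/-- An automorphism of the Hadamard matrix of order `12` fixing five rows is trivial. -/
theorem hadamard12_rigid {π ρ : Fin 12 → Fin 12} (hπ : ∀ i : Fin 12, i.val < 5 → π i = i)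
    (h : ∀ i j, hadamard12 (π i) (ρ j) = (hadamard12 i j ^^ hadamard12 (π i) (ρ 0))) :
    (∀ i, π i = i) ∧ ∀ j, ρ j = j := by
  have h0 : ρ 0 = 0 := hadamard12_column_shift _ fun j => ⟨ρ j, fun i hi => by
    have := h i j
    rwa [hπ i hi] at this⟩
  simp only [h0, hadamard12_zero_right, Bool.xor_false] at h
  have h1 : ∀ j, j ≠ 5 → j ≠ 10 → ρ j = j := fun j => hadamard12_column_eq j _ fun i hi => by
    have := h i j
    rwa [hπ i hi] at this
  have h2 : ∀ i, π i = i := fun i => hadamard12_row_eq _ _ fun j hj hj' => by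
    have := h i j
    rwa [h1 j hj hj'] at this
  refine ⟨h2, fun j => hadamard12_column_injective _ _ fun i => ?_⟩
  have := h i j
  rwa [h2 i] at this

section AlgebraicIdentity

variable {R : Type*} [CommRing R]

/-- The quartic polynomial occurring in `f_D`. -/
def quarticP (u x : R) : R :=
  1188 * u * x ^ 3 + 198 * u * x ^ 2 - 1346 * u * x - 27 * u + 594 * x ^ 4 - 7920 * x ^ 2
    - 1474 * x + 135

/-- Numerator of the function on pairs of roots whose square is `X * Y`. -/
def pairNum (u X Y y : R) : R :=
    (62762119218 + 0 * u) * Y ^ 6 + (1022790090960 - 246399431004 * u) * X * Y ^ 5 * y +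
    (1892161668276 + 316135119024 * u) * X ^ 2 * Y ^ 4 * y +
    (-53049149208 + 119111162742 * u) * X ^ 3 * Y ^ 3 * y +
    (230127770466 + 104603532030 * u) * X * Y ^ 5 * y ^ 2 +
    (-567269689338 + 134219676078 * u) * X ^ 2 * Y ^ 4 * y ^ 2 +
    (352995866784 - 66547042020 * u) * X ^ 3 * Y ^ 3 * y ^ 2 +
    (-391698720270 + 42524635986 * u) * X ^ 4 * Y ^ 2 * y ^ 2 +
    (115160322618 - 214623801198 * u) * X ^ 5 * Y * y ^ 2 +
    (120140099497 - 937261883 * u) * X ^ 6 * y ^ 2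

/-- Denominator of the function on pairs of roots whose square is `X * Y`. -/
def pairDen (u X Y y : R) : R :=
    (52301766015 + 10460353203 * u) * Y ^ 5 + (115063885233 - 115063885233 * u) * Y ^ 5 * y +
    (2156382441774 - 51914345526 * u) * X * Y ^ 4 * y +
    (593295417990 + 351870274746 * u) * X ^ 2 * Y ^ 3 * y +
    (115063885233 + 10460353203 * u) * Y ^ 5 * y ^ 2 +
    (-76709256822 + 216180632862 * u) * X * Y ^ 4 * y ^ 2 +
    (-340614354366 - 72175002210 * u) * X ^ 2 * Y ^ 3 * y ^ 2 +
    (282263667840 + 92267841636 * u) * X ^ 3 * Y ^ 2 * y ^ 2 +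
    (-429734858058 - 174587042142 * u) * X ^ 4 * Y * y ^ 2 +
    (313500344850 - 82592764686 * u) * X ^ 5 * y ^ 2

theorem pairNum_sq_sub {u : R} (hu : u ^ 2 = -11) (X Y y : R) :
    104976 * (pairNum u X Y y ^ 2 - X * Y * pairDen u X Y y ^ 2) =
      (26244 + 0 * u) * 15756334434937779726096 * X ^ 0 * Y ^ 12 * y ^ 0 +
      (28928446272 - 80887892112 * u) * 44472484532444184 * X ^ 3 * Y ^ 9 * y ^ 1 +
      (-158870011842710784 - 8926919275340880 * u) * 125524238436 * X ^ 6 * Y ^ 6 * y ^ 2 +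
      (-3049071516813966668640 + 8509480230225468076704 * u) * 354294 * X ^ 9 * Y ^ 3 * y ^ 3 +
      (1514171771607766704785779680 - 23641169603134608751213152 * u) * 1 * X ^ 12 * Y ^ 0 * y ^ 4 -
      15756334434937779726096 * X * Y ^ 11 * ((135 + 27 * u) * quarticP (-u) y) := by
  unfold pairNum pairDen quarticP
  linear_combination (104976 * (((-246399431004) * X * Y ^ 5 * y + 316135119024 * X ^ 2 * Y ^ 4 * y +
    119111162742 * X ^ 3 * Y ^ 3 * y + 104603532030 * X * Y ^ 5 * y ^ 2 +
    134219676078 * X ^ 2 * Y ^ 4 * y ^ 2 + (-66547042020) * X ^ 3 * Y ^ 3 * y ^ 2 +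
    42524635986 * X ^ 4 * Y ^ 2 * y ^ 2 + (-214623801198) * X ^ 5 * Y * y ^ 2 +
    (-937261883) * X ^ 6 * y ^ 2) ^ 2 -
    X * Y * (10460353203 * Y ^ 5 + (-115063885233) * Y ^ 5 * y + (-51914345526) * X * Y ^ 4 * y +
    351870274746 * X ^ 2 * Y ^ 3 * y + 10460353203 * Y ^ 5 * y ^ 2 +
    216180632862 * X * Y ^ 4 * y ^ 2 + (-72175002210) * X ^ 2 * Y ^ 3 * y ^ 2 +
    92267841636 * X ^ 3 * Y ^ 2 * y ^ 2 + (-174587042142) * X ^ 4 * Y * y ^ 2 +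
    (-82592764686) * X ^ 5 * y ^ 2) ^ 2) -
    15756334434937779726096 * X * Y ^ 11 * (27 * (1188 * y ^ 3 + 198 * y ^ 2 - 1346 * y - 27))) * hu

theorem pairNum_sq {F : Type*} [Field F] [CharZero F] {u a b : F} (hu : u ^ 2 = -11)
    (hab : 354294 * a * quarticP (-u) b ^ 3 = (349805 - 16951 * u) * quarticP u a ^ 3 * b) :
    pairNum u (quarticP u a) (quarticP (-u) b) b ^ 2 =
      quarticP u a * quarticP (-u) b * pairDen u (quarticP u a) (quarticP (-u) b) b ^ 2 := by
  have key := pairNum_sq_sub hu (quarticP u a) (quarticP (-u) b) b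
  have hX : quarticP u a = 1188 * u * a ^ 3 + 198 * u * a ^ 2 - 1346 * u * a - 27 * u
    + 594 * a ^ 4 - 7920 * a ^ 2 - 1474 * a + 135 := rfl
  set X := quarticP u a with hXdef
  set Y := quarticP (-u) b with hYdef
  have q0 : ((26244 + 0 * u) : F) = (135 + 27 * u) * (135 - 27 * u) * (349805 - 16951 * u) ^ 0 := by
    linear_combination (-((-729) * u ^ 0)) * hu
  have q1 : ((28928446272 - 80887892112 * u) : F) =
      (135 + 27 * u) * (-1474 - 1346 * u) * (349805 - 16951 * u) ^ 1 := by
    linear_combination (-((-8957831202) * u ^ 0 + (616033242) * u ^ 1)) * hu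
  have q2 : ((-158870011842710784 - 8926919275340880 * u) : F) =
      (135 + 27 * u) * (-7920 + 198 * u) * (349805 - 16951 * u) ^ 2 := by
    linear_combination (-((2548992453307344) * u ^ 0 + (-117162204373170) * u ^ 1 +
      (1536100399746) * u ^ 2)) * hu
  have q3 : ((-3049071516813966668640 + 8509480230225468076704 * u) : F) =
      (135 + 27 * u) * (0 + 1188 * u) * (349805 - 16951 * u) ^ 3 := by
    linear_combination (-((277188319710360606240) * u ^ 0 + (-149515869072062793564) * u ^ 1 +
      (8890887669713858160) * u ^ 2 + (-156230627256566676) * u ^ 3)) * hu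
  have q4 : ((1514171771607766704785779680 - 23641169603134608751213152 * u) : F) =
      (135 + 27 * u) * (594 + 0 * u) * (349805 - 16951 * u) ^ 4 := by
    linear_combination (-((-28500008894081624069514630) * u ^ 0 +
      (2822260228972396283681082) * u ^ 1 + (-102679845728401457884170) * u ^ 2 +
      (1324132681313030862438) * u ^ 3)) * hu
  have h2 := congrArg (fun z => z ^ 2) hab
  have h3 := congrArg (fun z => z ^ 3) hab
  have h4 := congrArg (fun z => z ^ 4) hab
  simp only [mul_pow] at h2 h3 h4
  rw [q0, q1, q2, q3, q4] at key
  have : (104976 : F) * (pairNum u X Y b ^ 2 - X * Y * pairDen u X Y b ^ 2) = 0 := by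
    rw [key]
    linear_combination
      (-((135 + 27 * u) * (-1474 - 1346 * u) * 44472484532444184 * Y ^ 9)) * hab +
      (-((135 + 27 * u) * (-7920 + 198 * u) * 125524238436 * Y ^ 6)) * h2 +
      (-((135 + 27 * u) * (0 + 1188 * u) * 354294 * Y ^ 3)) * h3 +
      (-((135 + 27 * u) * (594 + 0 * u) * 1 * Y ^ 0)) * h4 -
      15756334434937779726096 * Y ^ 12 * (135 + 27 * u) * hX
  rcases mul_eq_zero.1 this with h | h
  · norm_num at h
  · exact sub_eq_zero.1 h

end AlgebraicIdentity

section Places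

/-- A subring `T` of `N × k` is the graph of a place of `N` with values in `k`. -/
structure IsPlaceGraph {N k : Type*} [Field N] [Field k] (T : Subring (N × k)) : Prop where
  eq_zero : ∀ y, ((0 : N), y) ∈ T → y = 0
  inv_mem : ∀ x y, (x, y) ∈ T → y ≠ 0 → (x⁻¹, y⁻¹) ∈ T

/-- The graph of the place of `N` attached to a ring homomorphism from a subring to a field. -/
def placeGraph {S N k : Type*} [CommRing S] [Field N] [Algebra S N] [Field k] (ψ : S →+* k) :
    Subring (N × k) where
  carrier := {z | ∃ s d : S, ψ d ≠ 0 ∧ z.1 * algebraMap S N d = algebraMap S N s ∧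
    ψ s = z.2 * ψ d}
  mul_mem' := by
    rintro ⟨x, y⟩ ⟨x', y'⟩ ⟨s, d, h1, h2, h3⟩ ⟨s', d', h1', h2', h3'⟩
    refine ⟨s * s', d * d', by rw [map_mul]; exact mul_ne_zero h1 h1', ?_, ?_⟩
    · simp only [map_mul, Prod.mk_mul_mk] at *
      rw [← h2, ← h2']; ring
    · simp only [map_mul, Prod.mk_mul_mk] at *
      rw [h3, h3']; ring
  one_mem' := ⟨1, 1, by simp, by simp, by simp⟩
  add_mem' := by
    rintro ⟨x, y⟩ ⟨x', y'⟩ ⟨s, d, h1, h2, h3⟩ ⟨s', d', h1', h2', h3'⟩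
    refine ⟨s * d' + s' * d, d * d', by rw [map_mul]; exact mul_ne_zero h1 h1', ?_, ?_⟩
    · simp only [map_mul, map_add, Prod.mk_add_mk] at *
      rw [← h2, ← h2']; ring
    · simp only [map_mul, map_add, Prod.mk_add_mk] at *
      rw [h3, h3']; ring
  zero_mem' := ⟨0, 1, by simp, by simp, by simp⟩
  neg_mem' := by
    rintro ⟨x, y⟩ ⟨s, d, h1, h2, h3⟩
    refine ⟨-s, d, h1, ?_, ?_⟩
    · simp only [map_neg, Prod.neg_mk] at *
      rw [← h2]; ring
    · simp only [map_neg, Prod.neg_mk] at *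
      rw [h3]; ring

theorem isPlaceGraph_placeGraph {S N k : Type*} [CommRing S] [Field N] [Algebra S N] [Field k]
    (hinj : Function.Injective (algebraMap S N)) (ψ : S →+* k) :
    IsPlaceGraph (placeGraph (N := N) ψ) where
  eq_zero := by
    rintro y ⟨s, d, h1, h2, h3⟩
    have hs : s = 0 := hinj (by rw [← h2]; simp)
    rw [hs, map_zero] at h3
    exact (mul_eq_zero.1 h3.symm).resolve_right h1
  inv_mem := by
    rintro x y ⟨s, d, h1, h2, h3⟩ hy
    simp only at h2 h3
    have hs : ψ s ≠ 0 := by rw [h3]; exact mul_ne_zero hy h1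
    have hs' : algebraMap S N s ≠ 0 := by
      intro h
      exact hs (by rw [hinj (h.trans (map_zero _).symm), map_zero])
    have hx : x ≠ 0 := by
      rintro rfl
      rw [zero_mul] at h2
      exact hs' h2.symm
    refine ⟨d, s, hs, ?_, ?_⟩
    · simp only
      rw [← h2]; field_simp
    · simp only
      rw [h3]; field_simp

universe v w

theorem exists_place {R : Type*} {F : Type v} {N : Type w} [CommRing R] [IsDomain R]
    [IsIntegrallyClosed R] [Field F] [Algebra R F] [IsFractionRing R F] [Field N] [Algebra F N]
    [FiniteDimensional F N] [IsGalois F N] [Algebra R N] [IsScalarTower R F N] {p : ℕ}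
    (hp : p.Prime) (χ : R →+* ZMod p) :
    ∃ (k : Type w) (_ : Field k) (_ : CharP k p) (T : Subring (N × k)) (φ : N ≃ₐ[F] N),
      IsPlaceGraph T ∧ (∀ r : R, (algebraMap R N r, ZMod.castHom (dvd_refl p) k (χ r)) ∈ T) ∧
      (∀ x, IsIntegral R x → ∃ y, (x, y) ∈ T) ∧ ∀ x y, (x, y) ∈ T → (φ x, y ^ p) ∈ T := by
  have := Fact.mk hp
  have hχ : Function.Surjective χ := fun z => by
    obtain ⟨n, rfl⟩ := ZMod.intCast_surjective z
    exact ⟨n, map_intCast χ n⟩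
  let S := integralClosure R N
  let P := RingHom.ker χ
  have hP : P.IsMaximal := RingHom.ker_isMaximal_of_surjective χ hχ
  have hinjRN : Function.Injective (algebraMap R N) := by
    rw [IsScalarTower.algebraMap_eq R F N]
    exact (algebraMap F N).injective.comp (IsFractionRing.injective R F)
  have hinjS : Function.Injective (algebraMap S N) := Subtype.val_injective
  have hinjRS : Function.Injective (algebraMap R S) := by
    intro x y h
    exact hinjRN (congrArg (algebraMap S N) h)
  obtain ⟨Q, hQ, hQP⟩ := Ideal.exists_ideal_over_maximal_of_isIntegral (S := S) P (by
    rw [(RingHom.injective_iff_ker_eq_bot _).1 hinjRS]; exact bot_le)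
  have hover : Q.LiesOver P := ⟨hQP.symm⟩
  have hinv : Algebra.IsInvariant R S (N ≃ₐ[F] N) := by
    refine ⟨fun b hb => ?_⟩
    have h1 : (b : N) ∈ (⊥ : IntermediateField F N) := by
      rw [IsGalois.mem_bot_iff_fixed]
      intro f
      exact congrArg Subtype.val (hb f)
    obtain ⟨f, hf⟩ := IntermediateField.mem_bot.1 h1
    have h2 : IsIntegral R f := by
      rw [← isIntegral_algebraMap_iff (algebraMap F N).injective, hf]
      exact b.2
    obtain ⟨r, rfl⟩ := IsIntegrallyClosed.isIntegral_iff.1 h2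
    refine ⟨r, Subtype.ext ?_⟩
    rw [← hf, ← IsScalarTower.algebraMap_apply]
    rfl
  let eP := RingHom.quotientKerEquivOfSurjective hχ
  have hfin : Finite (R ⧸ P) := Finite.of_equiv _ eP.symm.toEquiv
  have hcard : Nat.card (R ⧸ P) = p := by
    rw [Nat.card_congr eP.toEquiv, Nat.card_zmod]
  let fP := Ideal.Quotient.field P
  let fQ := Ideal.Quotient.field Q
  have hsep : Algebra.IsSeparable (R ⧸ P) (S ⧸ Q) := inferInstance
  have hmf : Module.Finite (R ⧸ P) (S ⧸ Q) :=
    Ideal.Quotient.finite_of_isInvariant (N ≃ₐ[F] N) P Q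
  have hfQ : Finite (S ⧸ Q) := Module.finite_of_finite (R ⧸ P)
  obtain ⟨φ, hφ⟩ := IsArithFrobAt.exists_of_isInvariant R (N ≃ₐ[F] N) Q
  let ψ : S →+* S ⧸ Q := Ideal.Quotient.mk Q
  have hker : ∀ r : R, χ r = 0 → ψ (algebraMap R S r) = 0 := by
    intro r hr
    rw [Ideal.Quotient.eq_zero_iff_mem, ← Ideal.mem_comap, hQP]
    exact hr
  have hchar : CharP (S ⧸ Q) p := by
    have h0 : ((p : ℕ) : S ⧸ Q) = 0 := by
      have := hker (p : R) (by simp)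
      simpa using this
    have h1 := CharP.exists (S ⧸ Q)
    obtain ⟨q, hq⟩ := h1
    have h2 : q ∣ p := (CharP.cast_eq_zero_iff (S ⧸ Q) q p).1 h0
    rcases (Nat.dvd_prime hp).1 h2 with h | h
    · exact (CharP.char_ne_one (S ⧸ Q) q h).elim
    · rwa [h] at hq
  have hφ' : ∀ s : S, ψ (φ • s) = ψ s ^ p := by
    intro s
    have h1 := hφ s
    have h2 : Ideal.under R Q = P := hQP
    rw [h2, hcard] at h1
    have h3 := Ideal.Quotient.eq.2 h1
    rw [map_pow] at h3
    exact h3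
  refine ⟨S ⧸ Q, fQ, hchar, placeGraph ψ, φ, isPlaceGraph_placeGraph hinjS ψ, ?_, ?_, ?_⟩
  · intro r
    refine ⟨algebraMap R S r, 1, by simp, by simp, ?_⟩
    obtain ⟨n, hn⟩ := ZMod.intCast_surjective (χ r)
    have h1 := hker (r - n) (by rw [map_sub, map_intCast, hn, sub_self])
    rw [map_sub, map_sub, map_intCast, map_intCast, sub_eq_zero] at h1
    rw [h1, ← hn]
    simp
  · intro x hx
    exact ⟨ψ ⟨x, hx⟩, ⟨x, hx⟩, 1, by simp, by simp, by simp⟩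
  · rintro x y ⟨s, d, h1, h2, h3⟩
    simp only at h2 h3
    refine ⟨φ • s, φ • d, ?_, ?_, ?_⟩
    · rw [hφ']; exact pow_ne_zero _ h1
    · simp only
      change φ x * φ (algebraMap S N d) = φ (algebraMap S N s)
      rw [← map_mul, h2]
    · simp only
      rw [hφ', hφ', h3, mul_pow]

end Places

section ListPolynomials

/-- The value at `x` of the polynomial with the given list of coefficients. -/
def evalL {R : Type*} [CommRing R] (l : List ℤ) (x : R) : R :=
  l.foldr (fun (c : ℤ) (s : R) => (c : R) + x * s) 0

/-- Addition of coefficient lists modulo `p`. -/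
def addL (p : ℤ) : List ℤ → List ℤ → List ℤ
  | [], b => b
  | a, [] => a
  | c :: a, d :: b => ((c + d) % p) :: addL p a b

/-- Multiplication of a coefficient list by a scalar modulo `p`. -/
def smulL (p c : ℤ) (l : List ℤ) : List ℤ := l.map fun d => c * d % p

/-- Multiplication of coefficient lists modulo `p`. -/
def mulL (p : ℤ) (a b : List ℤ) : List ℤ :=
  a.foldr (fun c s => addL p (smulL p c b) (0 :: s)) []

/-- Multiplication by the variable, modulo `p` and `X ^ 12 - r`. -/
def mulXL (p : ℤ) (r l : List ℤ) : List ℤ :=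
  addL p (0 :: l.take 11) (mulL p r (l.drop 11))

/-- Multiplication of coefficient lists modulo `p` and `X ^ 12 - r`. -/
def mulModL (p : ℤ) (r a b : List ℤ) : List ℤ :=
  a.foldr (fun c s => addL p (smulL p c b) (mulXL p r s)) []

/-- Composition of coefficient lists modulo `p` and `X ^ 12 - r`. -/
def compL (p : ℤ) (r a b : List ℤ) : List ℤ :=
  a.foldr (fun c s => addL p [c] (mulModL p r b s)) []

/-- The polynomial `X ^ p ^ m` modulo `p` and `X ^ 12 - r`. -/
def frobL (p : ℕ) (r : List ℤ) : ℕ → List ℤ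
  | 0 => [0, 1]
  | m + 1 => compL p r (frobL p r m) ((mulXL p r)^[p] [1])

/-- Equality of coefficient lists modulo `p`. -/
def eqL (p : ℤ) (a b : List ℤ) : Bool := (addL p a (smulL p (-1) b)).all fun c => c % p == 0

variable {R : Type*} [CommRing R]

@[simp] theorem evalL_nil (x : R) : evalL [] x = 0 := rfl

@[simp] theorem evalL_cons (c : ℤ) (l : List ℤ) (x : R) :
    evalL (c :: l) x = c + x * evalL l x := rfl

theorem map_evalL {S : Type*} [CommRing S] (f : R →+* S) (l : List ℤ) (x : R) :
    f (evalL l x) = evalL l (f x) := by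
  induction l with
  | nil => simp
  | cons c l ih => simp [ih]

theorem evalL_append (a b : List ℤ) (x : R) :
    evalL (a ++ b) x = evalL a x + x ^ a.length * evalL b x := by
  induction a with
  | nil => simp
  | cons c a ih => simp only [List.cons_append, evalL_cons, ih, List.length_cons]; ring

theorem evalL_take_drop (n : ℕ) (l : List ℤ) (x : R) :
    evalL l x = evalL (l.take n) x + x ^ n * evalL (l.drop n) x := by
  induction n generalizing l with
  | zero => simp
  | succ n ih =>
    cases l with
    | nil => simp
    | cons c l => simp only [List.take_succ_cons, List.drop_succ_cons, evalL_cons]; rw [ih l]; ring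

variable {p : ℕ} [CharP R p]

theorem intCast_emod_charP (a : ℤ) : ((a % (p : ℤ) : ℤ) : R) = a := by
  rw [Int.emod_def]
  push_cast
  rw [CharP.cast_eq_zero R p]
  ring

theorem evalL_addL (a b : List ℤ) (x : R) : evalL (addL p a b) x = evalL a x + evalL b x := by
  induction a generalizing b with
  | nil => simp [addL]
  | cons c a ih =>
    cases b with
    | nil => simp [addL]
    | cons d b =>
      simp only [addL, evalL_cons, ih, intCast_emod_charP]
      push_cast
      ring

theorem evalL_smulL (c : ℤ) (l : List ℤ) (x : R) : evalL (smulL p c l) x = c * evalL l x := by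
  induction l with
  | nil => simp [smulL]
  | cons d l ih =>
    simp only [smulL, List.map_cons, evalL_cons, intCast_emod_charP] at ih ⊢
    rw [ih]
    push_cast
    ring

theorem evalL_mulL (a b : List ℤ) (x : R) : evalL (mulL p a b) x = evalL a x * evalL b x := by
  induction a with
  | nil => simp [mulL]
  | cons c a ih =>
    simp only [mulL, List.foldr_cons, evalL_addL, evalL_smulL, evalL_cons] at ih ⊢
    rw [ih]
    push_cast
    ring

theorem evalL_mulXL {r : List ℤ} {x : R} (hx : x ^ 12 = evalL r x) (l : List ℤ) :
    evalL (mulXL p r l) x = x * evalL l x := by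
  rw [mulXL, evalL_addL, evalL_mulL, ← hx, evalL_take_drop 11 l x, evalL_cons]
  push_cast
  ring

theorem evalL_mulModL {r : List ℤ} {x : R} (hx : x ^ 12 = evalL r x) (a b : List ℤ) :
    evalL (mulModL p r a b) x = evalL a x * evalL b x := by
  induction a with
  | nil => simp [mulModL]
  | cons c a ih =>
    simp only [mulModL, List.foldr_cons, evalL_addL, evalL_smulL, evalL_cons] at ih ⊢
    rw [evalL_mulXL hx, ih]
    ring

theorem evalL_compL {r : List ℤ} {x : R} (hx : x ^ 12 = evalL r x) (a b : List ℤ) :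
    evalL (compL p r a b) x = evalL a (evalL b x) := by
  induction a with
  | nil => simp [compL]
  | cons c a ih =>
    simp only [compL, List.foldr_cons, evalL_addL, evalL_cons, evalL_nil] at ih ⊢
    rw [evalL_mulModL hx, ih]
    ring

theorem evalL_pow_char (hp : p.Prime) (l : List ℤ) (x : R) : evalL l x ^ p = evalL l (x ^ p) := by
  have := Fact.mk hp
  exact map_evalL (frobenius R p) l x

theorem evalL_frobL (hp : p.Prime) {r : List ℤ} {x : R} (hx : x ^ 12 = evalL r x) (m : ℕ) :
    evalL (frobL p r m) x = x ^ p ^ m := by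
  induction m with
  | zero => simp [frobL]
  | succ m ih =>
    have h1 : ∀ n : ℕ, evalL ((mulXL p r)^[n] [1]) x = x ^ n := by
      intro n
      induction n with
      | zero => simp
      | succ n ihn => rw [Function.iterate_succ_apply', evalL_mulXL hx, ihn, pow_succ']
    rw [frobL, evalL_compL hx, h1, ← evalL_pow_char hp, ih, ← pow_mul, pow_succ]

theorem evalL_eq_of_eqL {a b : List ℤ} (h : eqL p a b = true) (x : R) :
    evalL a x = evalL b x := by
  have h1 : ∀ l : List ℤ, (l.all fun c => c % (p : ℤ) == 0) = true → evalL l x = 0 := by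
    intro l hl
    induction l with
    | nil => simp
    | cons c l ih =>
      simp only [List.all_cons, Bool.and_eq_true, beq_iff_eq] at hl
      rw [evalL_cons, ih hl.2, ← intCast_emod_charP (p := p), hl.1]
      simp
  have h2 := h1 _ h
  rw [evalL_addL, evalL_smulL] at h2
  push_cast at h2
  linear_combination h2

end ListPolynomials

section RootCounts

variable {k : Type*} [Field k]

theorem card_evalL_roots_le {ι : Type*} [Fintype ι] {r : ι → k} (hr : Function.Injective r)
    (l : List ℤ) [DecidableEq k] :
    (Finset.univ.filter fun i => evalL (l ++ [1]) (r i) = 0).card ≤ l.length := by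
  have hdeg : ∀ l : List ℤ, (evalL l (X : k[X])).degree < l.length := by
    intro l
    induction l with
    | nil => simp
    | cons c l ih =>
      rw [evalL_cons, List.length_cons]
      refine (degree_add_le _ _).trans_lt (max_lt ?_ ?_)
      · rw [← map_intCast (C : k →+* k[X])]
        exact degree_C_le.trans_lt (by exact_mod_cast Nat.succ_pos _)
      · rw [degree_mul, degree_X, add_comm]
        push_cast
        exact WithBot.add_lt_add_right (by simp) ih
  have hm := monic_X_pow_add (hdeg l)
  have hnd : (X ^ l.length + evalL l (X : k[X])).natDegree = l.length :=
    (natDegree_add_eq_left_of_degree_lt (by rw [degree_X_pow]; exact hdeg l)).trans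
      (natDegree_X_pow _)
  rw [← hnd]
  refine le_trans ?_ (card_roots' _)
  refine le_trans ?_ (Multiset.toFinset_card_le _)
  rw [← Finset.card_image_of_injective _ hr]
  apply Finset.card_le_card
  intro y hy
  obtain ⟨i, hi, rfl⟩ := Finset.mem_image.1 hy
  rw [Multiset.mem_toFinset, mem_roots hm.ne_zero, IsRoot.def]
  have h1 := (Finset.mem_filter.1 hi).2
  rw [evalL_append] at h1
  rw [eval_add, eval_pow, eval_X, ← coe_evalRingHom, map_evalL]
  simp only [coe_evalRingHom, eval_X]
  simp at h1
  rw [add_comm]; exact h1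

variable {p : ℕ} [CharP k p]

/-- Certificate that the polynomial `X ^ 12 - r` has exactly `n` roots fixed by the `m`-th power of
Frobenius. -/
theorem card_frobenius_fixed [DecidableEq k] (hp : p.Prime) {r : Fin 12 → k}
    (hr : Function.Injective r)
    {R h g U q : List ℤ} (hR : ∀ i, r i ^ 12 = evalL R (r i)) (m : ℕ)
    (hlen : h.length + g.length = 12)
    (hfac : eqL p (mulL p (h ++ [1]) (g ++ [1])) (addL p [0, 0, 0, 0, 0, 0, 0, 0, 0, 0, 0, 0, 1]
      (smulL p (-1) R)) = true)
    (hU : eqL p (mulModL p R U (addL p (frobL p R m) [0, -1])) (h ++ [1]) = true)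
    (hq : eqL p (mulModL p R q (h ++ [1])) (addL p (frobL p R m) [0, -1]) = true) :
    (Finset.univ.filter fun i => r i ^ p ^ m = r i).card = h.length := by
  have e1 : ∀ i, evalL (h ++ [1]) (r i) = 0 ↔ r i ^ p ^ m = r i := by
    intro i
    have hU' := evalL_eq_of_eqL hU (r i)
    have hq' := evalL_eq_of_eqL hq (r i)
    rw [evalL_mulModL (hR i), evalL_addL, evalL_frobL hp (hR i)] at hU' hq'
    simp only [evalL_cons, evalL_nil] at hU' hq'
    push_cast at hU' hq'
    constructor
    · intro hi
      rw [hi] at hq'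
      linear_combination -hq'
    · intro hi
      rw [← hU', hi]
      ring
  have e2 : ∀ i, evalL (h ++ [1]) (r i) = 0 ∨ evalL (g ++ [1]) (r i) = 0 := by
    intro i
    have := evalL_eq_of_eqL hfac (r i)
    rw [evalL_mulL, evalL_addL, evalL_smulL, ← hR i] at this
    simp only [evalL_cons, evalL_nil] at this
    push_cast at this
    rw [← mul_eq_zero, this]
    ring
  have c1 := card_evalL_roots_le hr h
  have c2 := card_evalL_roots_le hr g
  have c3 : (Finset.univ : Finset (Fin 12)) =
      (Finset.univ.filter fun i => evalL (h ++ [1]) (r i) = 0) ∪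
        Finset.univ.filter fun i => evalL (g ++ [1]) (r i) = 0 := by
    ext i
    simpa using e2 i
  have c4 := Finset.card_union_le (Finset.univ.filter fun i => evalL (h ++ [1]) (r i) = 0)
    (Finset.univ.filter fun i => evalL (g ++ [1]) (r i) = 0)
  rw [← c3, Finset.card_univ, Fintype.card_fin] at c4
  simp only [e1] at c1 c4
  omega

end RootCounts

section PolyF

variable {R : Type*} [CommRing R]

/-- The polynomial `f_D`, with `√-11` and `t` specialized to `u` and `t`. -/
noncomputable def polyF (u t : R) : R[X] :=
  -11 ^ 2 * C u * quarticP (C u) X ^ 3 - 2 ^ 8 * 3 ^ 13 * (253 * C u - 67) * C t * X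

theorem map_quarticP {S : Type*} [CommRing S] (f : R →+* S) (u x : R) :
    f (quarticP u x) = quarticP (f u) (f x) := by
  simp only [quarticP, map_add, map_sub, map_mul, map_pow, map_ofNat]

theorem map_polyF {S : Type*} [CommRing S] (f : R →+* S) (u t : R) :
    (polyF u t).map f = polyF (f u) (f t) := by
  have h := map_quarticP (mapRingHom f) (C u) X
  rw [coe_mapRingHom, map_C, map_X] at h
  simp [polyF, h]

theorem eval_polyF (u t x : R) : (polyF u t).eval x =
    -11 ^ 2 * u * quarticP u x ^ 3 - 2 ^ 8 * 3 ^ 13 * (253 * u - 67) * t * x := by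
  have h := map_quarticP (evalRingHom x) (C u) X
  rw [coe_evalRingHom, eval_C, eval_X] at h
  simp [polyF, h]

/-- The leading coefficient of `polyF u t`. -/
def leadF (u : R) : R := -11 ^ 2 * 594 ^ 3 * u

/-- The coefficients of `f_D` modulo `p`. -/
def polyFL (p u t : ℤ) : List ℤ :=
  let q := [135 - 27 * u, -1474 - 1346 * u, -7920 + 198 * u, 1188 * u, 594]
  addL p (smulL p (-11 ^ 2 * u) (mulL p q (mulL p q q)))
    [0, -(2 ^ 8 * 3 ^ 13 * (253 * u - 67) * t)]

theorem evalL_polyFL {p : ℕ} [CharP R p] (u t : ℤ) (x : R) :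
    evalL (polyFL p u t) x =
      -11 ^ 2 * u * quarticP (u : R) x ^ 3 - 2 ^ 8 * 3 ^ 13 * (253 * u - 67) * t * x := by
  simp only [polyFL, evalL_addL, evalL_smulL, evalL_mulL, evalL_cons, evalL_nil, quarticP]
  push_cast
  ring

theorem evalL_polyFL_X {p : ℕ} [CharP R p] (u t : ℤ) :
    evalL (polyFL p u t) (X : R[X]) = polyF (u : R) (t : R) := by
  rw [evalL_polyFL, polyF]
  simp

theorem polyF_eq_sum (u t : R) : ∃ q : R[X], q.degree ≤ 10 ∧
    polyF u t = C (leadF u) * (X ^ 12 + C (6 * u) * X ^ 11) + q := by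
  refine ⟨polyF u t - C (leadF u) * (X ^ 12 + C (6 * u) * X ^ 11), ?_, by ring⟩
  have h : polyF u t - C (leadF u) * (X ^ 12 + C (6 * u) * X ^ 11) =
      -11 ^ 2 * C u * (
        3 * (594 * X ^ 4 + 1188 * C u * X ^ 3) ^ 2 *
          ((198 * C u - 7920) * X ^ 2 + (-1346 * C u - 1474) * X + (135 - 27 * C u)) +
        3 * (594 * X ^ 4 + 1188 * C u * X ^ 3) *
          ((198 * C u - 7920) * X ^ 2 + (-1346 * C u - 1474) * X + (135 - 27 * C u)) ^ 2 +
        ((198 * C u - 7920) * X ^ 2 + (-1346 * C u - 1474) * X + (135 - 27 * C u)) ^ 3 +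
        594 ^ 3 * (12 * C u ^ 2 * X ^ 10 + 8 * C u ^ 3 * X ^ 9)) -
      2 ^ 8 * 3 ^ 13 * (253 * C u - 67) * C t * X := by
    simp only [polyF, quarticP, leadF, map_mul, map_neg, map_pow, map_ofNat]
    ring
  rw [h]
  compute_degree

theorem natDegree_polyF {u : R} (hu : leadF u ≠ 0) (t : R) :
    (polyF u t).natDegree = 12 ∧ (polyF u t).leadingCoeff = leadF u ∧
      (polyF u t).coeff 11 = leadF u * (6 * u) := by
  obtain ⟨q, hq, h⟩ := polyF_eq_sum u t
  have h12 : q.coeff 12 = 0 := coeff_eq_zero_of_degree_lt (hq.trans_lt (by norm_num))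
  have h11 : q.coeff 11 = 0 := coeff_eq_zero_of_degree_lt (hq.trans_lt (by norm_num))
  have c12 : (polyF u t).coeff 12 = leadF u := by
    rw [h, coeff_add, coeff_C_mul, coeff_add, coeff_C_mul, coeff_X_pow, coeff_X_pow, h12]
    norm_num
  have c11 : (polyF u t).coeff 11 = leadF u * (6 * u) := by
    rw [h, coeff_add, coeff_C_mul, coeff_add, coeff_C_mul, coeff_X_pow, coeff_X_pow, h11]
    norm_num
  have hd : (polyF u t).natDegree = 12 := by
    refine natDegree_eq_of_le_of_coeff_ne_zero ?_ (by rw [c12]; exact hu)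
    rw [h]
    have : q.natDegree ≤ 12 := natDegree_le_of_degree_le (hq.trans (by norm_num))
    compute_degree!
  exact ⟨hd, by rw [leadingCoeff, hd, c12], c11⟩

end PolyF

section Derivative

variable {R : Type*} [CommRing R] {p : ℕ} [CharP R p]

/-- Coefficients of the derivative, modulo `p`. -/
def derivL (p : ℤ) : List ℤ → List ℤ
  | [] => []
  | _ :: l => addL p l (0 :: derivL p l)

theorem derivative_evalL (l : List ℤ) :
    derivative (evalL l (X : R[X])) = evalL (derivL p l) X := by
  induction l with
  | nil => simp [derivL]
  | cons c l ih =>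
    simp only [derivL, evalL_cons, evalL_addL, map_add, derivative_mul, ih]
    simp

theorem separable_evalL {a b l : List ℤ}
    (h : eqL p (addL p (mulL p a l) (mulL p b (derivL p l))) [1] = true) :
    (evalL l (X : R[X])).Separable := by
  refine ⟨evalL a X, evalL b X, ?_⟩
  have h1 := evalL_eq_of_eqL h (X : R[X])
  rw [evalL_addL, evalL_mulL, evalL_mulL, ← derivative_evalL] at h1
  rw [h1]
  simp

end Derivative

section Specialization

universe v w

theorem exists_specialization {R : Type*} {F : Type v} {N : Type w} [CommRing R] [IsDomain R]
    [IsIntegrallyClosed R] [Field F] [Algebra R F] [IsFractionRing R F] [Field N] [Algebra F N]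
    [FiniteDimensional F N] [IsGalois F N] [Algebra R N] [IsScalarTower R F N] {p : ℕ}
    (hp : p.Prime) (hp2 : p ≠ 2) {u : N} (hu : u ^ 2 = -11) {τ : N ≃ₐ[F] N} (hτ : τ u = -u)
    {u₀ t₀ : ℤ} (hu₀ : (u₀ : ZMod p) ^ 2 = -11) (hu₀' : (u₀ : ZMod p) ≠ 0) (χ : R →+* ZMod p)
    {t : R} (hχ : χ t = t₀) :
    ∃ (k : Type w) (_ : Field k) (_ : CharP k p) (T : Subring (N × k)) (φ : N ≃ₐ[F] N),
      IsPlaceGraph T ∧ (u, (u₀ : k)) ∈ T ∧ (algebraMap R N t, (t₀ : k)) ∈ T ∧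
      (∀ x, IsIntegral R x → ∃ y, (x, y) ∈ T) ∧ (∀ x y, (x, y) ∈ T → (φ x, y ^ p) ∈ T) ∧
      φ u = u := by
  have := Fact.mk hp
  obtain ⟨k, hk, hkp, T, φ, hT, hTR, hTint, hTφ⟩ := exists_place (F := F) (N := N) hp χ
  have hmod : ∀ {a b : ℤ}, (a : ZMod p) = b → (a : k) = b := by
    intro a b hab
    have := congrArg (ZMod.castHom (dvd_refl p) k) hab
    simpa using this
  have hu0 : (u₀ : k) ^ 2 = -11 := by
    have := hmod (a := u₀ ^ 2) (b := -11) (by push_cast; exact hu₀)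
    exact_mod_cast this
  have hne : (u₀ : k) ≠ 0 := by
    intro h
    apply hu₀'
    have h1 : ZMod.castHom (dvd_refl p) k (u₀ : ZMod p) = 0 := by simpa using h
    exact (map_eq_zero _).1 h1
  have h2 : (2 : k) ≠ 0 := by
    intro h
    have h3 : ((2 : ℕ) : k) = 0 := by exact_mod_cast h
    rw [CharP.cast_eq_zero_iff k p] at h3
    exact hp2 ((Nat.prime_dvd_prime_iff_eq hp Nat.prime_two).1 h3)
  have hT_int : IsIntegral R u := by
    refine IsIntegral.of_pow (n := 2) (by norm_num) ?_
    rw [hu]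
    have := isIntegral_algebraMap (R := R) (A := N) (x := -11)
    rwa [map_neg, map_ofNat] at this
  have hfix : ∀ ψ : N ≃ₐ[F] N, ψ u = u ∨ ψ u = -u := by
    intro ψ
    have h : ψ u ^ 2 = -11 := by rw [← map_pow, hu, map_neg, map_ofNat]
    exact sq_eq_sq_iff_eq_or_eq_neg.1 (h.trans hu.symm)
  have hτ' : τ (τ u) = u := by rw [hτ, map_neg, hτ, neg_neg]
  have hcast : ∀ n : ZMod p,
      (ZMod.castHom (dvd_refl p) k n) ^ p = ZMod.castHom (dvd_refl p) k n := by
    intro n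
    rw [← map_pow, ZMod.pow_card]
  have huni : ∀ {x : N} {y y' : k}, (x, y) ∈ T → (x, y') ∈ T → y = y' := by
    intro x y y' h h'
    have := T.sub_mem h h'
    rw [Prod.mk_sub_mk, sub_self] at this
    exact sub_eq_zero.1 (hT.eq_zero _ this)
  have hup : (u₀ : k) ^ p = u₀ := by
    have := hcast u₀
    simpa using this
  have main : ∃ (T : Subring (N × k)) (φ : N ≃ₐ[F] N),
      IsPlaceGraph T ∧ (u, (u₀ : k)) ∈ T ∧ (algebraMap R N t, (t₀ : k)) ∈ T ∧
      (∀ x, IsIntegral R x → ∃ y, (x, y) ∈ T) ∧ (∀ x y, (x, y) ∈ T → (φ x, y ^ p) ∈ T) := by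
    have htT : (algebraMap R N t, (t₀ : k)) ∈ T := by
      have := hTR t
      rw [hχ] at this
      simpa using this
    obtain ⟨y, hy⟩ := hTint u hT_int
    have hy2 : y ^ 2 = (u₀ : k) ^ 2 := by
      have h1 := T.pow_mem hy 2
      have h3 := hTR (-11)
      rw [Prod.pow_mk, hu] at h1
      simp only [map_neg, map_ofNat] at h3
      rw [hu0, huni h1 h3]
    rcases sq_eq_sq_iff_eq_or_eq_neg.1 hy2 with rfl | rfl
    · exact ⟨T, φ, hT, hy, htT, hTint, hTφ⟩
    · refine ⟨T.comap ((τ : N →+* N).prodMap (RingHom.id k)), τ.trans (φ.trans τ.symm),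
        ⟨?_, ?_⟩, ?_, ?_, ?_, ?_⟩
      · intro y hy
        refine hT.eq_zero y ?_
        have : (τ 0, y) ∈ T := hy
        rwa [map_zero] at this
      · intro x y h h0
        have : ((τ x)⁻¹, y⁻¹) ∈ T := hT.inv_mem _ _ h h0
        rw [← map_inv₀] at this
        exact this
      · change (τ u, (u₀ : k)) ∈ T
        have := T.neg_mem hy
        rwa [Prod.neg_mk, neg_neg, ← hτ] at this
      · change (τ (algebraMap R N t), (t₀ : k)) ∈ T
        rwa [IsScalarTower.algebraMap_apply R F N, AlgEquiv.commutes,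
          ← IsScalarTower.algebraMap_apply R F N]
      · intro x hx
        exact hTint (τ x) (hx.map ((τ.toAlgHom).restrictScalars R))
      · intro x y h
        change (τ (τ.symm (φ (τ x))), y ^ p) ∈ T
        rw [AlgEquiv.apply_symm_apply]
        exact hTφ _ _ h
  obtain ⟨T', φ', h1, h3, h4, h5, h6⟩ := main
  refine ⟨k, hk, hkp, T', φ', h1, h3, h4, h5, h6, ?_⟩
  rcases hfix φ' with h | h
  · exact h
  · exfalso
    have h7 := h6 _ _ h3
    rw [h, hup] at h7
    have h8 := T'.add_mem h7 h3
    rw [Prod.mk_add_mk, neg_add_cancel] at h8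
    have h9 := h1.eq_zero _ h8
    rw [← two_mul] at h9
    exact (mul_ne_zero h2 hne) h9

end Specialization

section RootImages

variable {N k : Type*} [Field N] [Field k] {T : Subring (N × k)}

theorem IsPlaceGraph.unique (hT : IsPlaceGraph T) {x : N} {y y' : k} (h : (x, y) ∈ T)
    (h' : (x, y') ∈ T) : y = y' := by
  have := T.sub_mem h h'
  rw [Prod.mk_sub_mk, sub_self] at this
  exact sub_eq_zero.1 (hT.eq_zero _ this)

theorem IsPlaceGraph.polyF_eq_prod (hT : IsPlaceGraph T) {u t : N} {u₀ t₀ : k}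
    (hu : (u, u₀) ∈ T) (ht : (t, t₀) ∈ T) {α : Fin 12 → N} {r : Fin 12 → k}
    (hα : polyF u t = C (leadF u) * ∏ i, (X - C (α i))) (hr : ∀ i, (α i, r i) ∈ T) :
    polyF u₀ t₀ = C (leadF u₀) * ∏ i, (X - C (r i)) := by
  let f₁ : T →+* N := (RingHom.fst N k).comp T.subtype
  let f₂ : T →+* k := (RingHom.snd N k).comp T.subtype
  have hf₁ : Function.Injective f₁ := by
    rintro ⟨⟨x, y⟩, h⟩ ⟨⟨x', y'⟩, h'⟩ hxx
    have hxx' : x = x' := hxx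
    subst hxx'
    have := hT.unique h h'
    subst this
    rfl
  let a : Fin 12 → T := fun i => ⟨_, hr i⟩
  have key : polyF (⟨_, hu⟩ : T) ⟨_, ht⟩ =
      C (leadF (⟨_, hu⟩ : T)) * ∏ i, (X - C (a i)) := by
    apply map_injective f₁ hf₁
    rw [map_polyF, Polynomial.map_mul, Polynomial.map_prod]
    simp only [Polynomial.map_sub, map_X, map_C]
    refine hα.trans ?_
    congr 2
  have h := congrArg (Polynomial.map f₂) key
  rw [map_polyF, Polynomial.map_mul, Polynomial.map_prod] at h
  simp only [Polynomial.map_sub, map_X, map_C] at h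
  refine Eq.trans h ?_
  congr 2

theorem IsPlaceGraph.exists_root_image {R : Type*} [CommRing R] [Algebra R N]
    (hT : IsPlaceGraph T) (hT_int : ∀ x : N, IsIntegral R x → ∃ y, (x, y) ∈ T) {u : N} {t : R}
    {u₀ : k} (hu : (u, u₀) ∈ T) (hlead : leadF u₀ ≠ 0) (hu' : u ^ 2 = -11) {x : N}
    (hx : (polyF u (algebraMap R N t)).eval x = 0) : ∃ y, (x, y) ∈ T := by
  have huint : IsIntegral R u := by
    refine IsIntegral.of_pow (n := 2) (by norm_num) ?_
    rw [hu']
    have := isIntegral_algebraMap (R := R) (A := N) (x := -11)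
    rwa [map_neg, map_ofNat] at this
  let S := integralClosure R N
  have hLT : (leadF u, leadF u₀) ∈ T := by
    have h := T.mul_mem (T.mul_mem (T.neg_mem (natCast_mem T (11 ^ 2))) (natCast_mem T (594 ^ 3))) hu
    have e : ((leadF u, leadF u₀) : N × k) =
        -((11 ^ 2 : ℕ) : N × k) * ((594 ^ 3 : ℕ) : N × k) * (u, u₀) := by
      ext <;> simp [leadF] <;> norm_num
    rwa [e]
  let u' : S := ⟨u, huint⟩
  have hne : leadF u' ≠ 0 := by
    intro h
    have h1 : leadF u = 0 := congrArg (algebraMap S N) h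
    rw [h1] at hLT
    exact hlead (hT.eq_zero _ hLT)
  have h1 := isIntegral_leadingCoeff_smul (polyF u' (algebraMap R S t)) x (by
    rw [aeval_def, ← eval_map, map_polyF]
    exact hx)
  rw [(natDegree_polyF hne _).2.1] at h1
  obtain ⟨y, hy⟩ := hT_int _ (isIntegral_trans _ h1)
  have h2 := T.mul_mem (hT.inv_mem _ _ hLT hlead) hy
  have h3 : (leadF u' • x : N) = leadF u * x := rfl
  rw [h3, Prod.mk_mul_mk, inv_mul_cancel_left₀] at h2
  · exact ⟨_, h2⟩
  · intro h
    rw [h] at hLT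
    exact hlead (hT.eq_zero _ hLT)

end RootImages

section RootAction

variable {N : Type*} [Field N] {u t : N} {α : Fin 12 → N}

theorem eval_polyF_eq_zero_iff (hu : leadF u ≠ 0)
    (hα : polyF u t = C (leadF u) * ∏ i, (X - C (α i))) {x : N} :
    (polyF u t).eval x = 0 ↔ ∃ i, x = α i := by
  rw [hα, eval_mul, eval_C, eval_prod, mul_eq_zero, or_iff_right hu, Finset.prod_eq_zero_iff]
  simp [sub_eq_zero]

variable {F : Type*} [Field F] [Algebra F N]

theorem exists_apply_root (hu : leadF u ≠ 0)
    (hα : polyF u t = C (leadF u) * ∏ i, (X - C (α i))) {σ : N ≃ₐ[F] N} (hσu : σ u = u)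
    (hσt : σ t = t) (i : Fin 12) : ∃ j, σ (α i) = α j := by
  rw [← eval_polyF_eq_zero_iff hu hα]
  have h : (polyF u t).eval (α i) = 0 := (eval_polyF_eq_zero_iff hu hα).2 ⟨i, rfl⟩
  have h1 := congrArg σ h
  rw [eval_polyF] at h1 ⊢
  simp only [map_sub, map_mul, map_pow, map_neg, map_ofNat, map_zero, hσu, hσt] at h1
  have h2 := map_quarticP (σ : N →+* N) u (α i)
  simp only [RingHom.coe_coe] at h2
  rw [h2, hσu] at h1
  exact h1

theorem exists_permHom (hu : leadF u ≠ 0)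
    (hα : polyF u t = C (leadF u) * ∏ i, (X - C (α i))) (hinj : Function.Injective α)
    (ht : ∀ σ : N ≃ₐ[F] N, σ t = t) :
    ∃ Φ : MulAction.stabilizer (N ≃ₐ[F] N) u →* Equiv.Perm (Fin 12),
      ∀ σ i, α (Φ σ i) = (σ : N ≃ₐ[F] N) (α i) := by
  have h : ∀ (σ : MulAction.stabilizer (N ≃ₐ[F] N) u) (i : Fin 12),
      ∃ j, (σ : N ≃ₐ[F] N) (α i) = α j := fun σ i =>
    exists_apply_root hu hα (MulAction.mem_stabilizer_iff.1 σ.2) (ht _) i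
  choose f hf using h
  let Ψ : MulAction.stabilizer (N ≃ₐ[F] N) u →* Function.End (Fin 12) :=
    { toFun := f
      map_one' := by
        funext i
        exact hinj (hf 1 i).symm
      map_mul' := by
        intro σ τ
        funext i
        apply hinj
        rw [← hf]
        change (σ : N ≃ₐ[F] N) ((τ : N ≃ₐ[F] N) (α i)) = α (f σ (f τ i))
        rw [hf, hf] }
  exact ⟨Ψ.toHomPerm, fun σ i => (hf σ i).symm⟩

theorem frobenius_pow {k : Type*} [Field k] {T : Subring (N × k)} (hT : IsPlaceGraph T)
    {r : Fin 12 → k} (hr : ∀ i, (α i, r i) ∈ T) {φ : N ≃ₐ[F] N} {p : ℕ}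
    (hφ : ∀ x y, (x, y) ∈ T → (φ x, y ^ p) ∈ T) {π : Equiv.Perm (Fin 12)}
    (hπ : ∀ i, α (π i) = φ (α i)) (m : ℕ) (i : Fin 12) : r ((π ^ m) i) = r i ^ p ^ m := by
  induction m with
  | zero => simp
  | succ m ih =>
    rw [pow_succ' π, Equiv.Perm.mul_apply, pow_succ, pow_mul, ← ih]
    have h := hφ _ _ (hr ((π ^ m) i))
    rw [← hπ] at h
    exact hT.unique (hr _) h

theorem injective_of_separable {k : Type*} [Field k] {u₀ t₀ : k} {r : Fin 12 → k}
    (hsep : (polyF u₀ t₀).Separable)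
    (h : polyF u₀ t₀ = C (leadF u₀) * ∏ i, (X - C (r i))) : Function.Injective r := by
  rw [h] at hsep
  exact separable_prod_X_sub_C_iff.1 hsep.of_mul_right

end RootAction

section PermBound

theorem card_le_of_pointwise_stabilizer {G : Subgroup (Equiv.Perm (Fin 12))}
    (h : ∀ g ∈ G, (∀ i : Fin 12, i.val < 5 → g i = i) → g = 1) : Nat.card G ≤ 95040 := by
  have hbound : ∀ (H : Subgroup (Equiv.Perm (Fin 12))) (x : Fin 12) (s : Finset (Fin 12)),
      (∀ a ∈ s, a ≠ x ∧ ∀ g ∈ H, g a = a) → (orbitFinset H x).card ≤ 12 - s.card := by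
    intro H x s hs
    have : orbitFinset H x ⊆ sᶜ := by
      intro y hy
      rw [Finset.mem_compl]
      intro hys
      exact orbitFinset_subset_fixed (hs y hys).2 (hs y hys).1.symm hy
    have := Finset.card_le_card this
    rwa [Finset.card_compl, Fintype.card_fin] at this
  have h0 := card_eq_orbit_mul_stab G 0
  have h1 := card_eq_orbit_mul_stab (pointStab G 0) 1
  have h2 := card_eq_orbit_mul_stab (pointStab (pointStab G 0) 1) 2
  have h3 := card_eq_orbit_mul_stab (pointStab (pointStab (pointStab G 0) 1) 2) 3
  have h4 := card_eq_orbit_mul_stab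
    (pointStab (pointStab (pointStab (pointStab G 0) 1) 2) 3) 4
  have b0 := hbound G 0 ∅ (by simp)
  have b1 := hbound (pointStab G 0) 1 {0} (by simp +contextual [mem_pointStab])
  have b2 := hbound (pointStab (pointStab G 0) 1) 2 {0, 1}
    (by simp +contextual [mem_pointStab])
  have b3 := hbound (pointStab (pointStab (pointStab G 0) 1) 2) 3 {0, 1, 2}
    (by simp +contextual [mem_pointStab])
  have b4 := hbound (pointStab (pointStab (pointStab (pointStab G 0) 1) 2) 3) 4 {0, 1, 2, 3}
    (by simp +contextual [mem_pointStab])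
  have e : pointStab (pointStab (pointStab (pointStab (pointStab G 0) 1) 2) 3) 4 = ⊥ := by
    rw [eq_bot_iff]
    intro g hg
    simp only [mem_pointStab] at hg
    obtain ⟨⟨⟨⟨⟨hG, g0⟩, g1⟩, g2⟩, g3⟩, g4⟩ := hg
    refine h g hG ?_
    intro i hi
    have : i = 0 ∨ i = 1 ∨ i = 2 ∨ i = 3 ∨ i = 4 := by omega
    rcases this with rfl | rfl | rfl | rfl | rfl <;> assumption
  rw [e, Subgroup.card_bot] at h4
  rw [h0, h1, h2, h3, h4]
  exact (Nat.mul_le_mul b0 (Nat.mul_le_mul b1 (Nat.mul_le_mul b2 (Nat.mul_le_mul b3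
    (Nat.mul_le_mul b4 le_rfl))))).trans (by decide)

end PermBound

section Signs

/-- The sign attached to a Boolean. -/
def boolSign (R : Type*) [CommRing R] (b : Bool) : R := if b then -1 else 1

variable {R : Type*} [CommRing R]

theorem boolSign_mul (a b : Bool) : boolSign R a * boolSign R b = boolSign R (a ^^ b) := by
  cases a <;> cases b <;> simp [boolSign]

theorem boolSign_sq (b : Bool) : boolSign R b ^ 2 = 1 := by
  cases b <;> simp [boolSign]

theorem map_boolSign {S : Type*} [CommRing S] (f : R →+* S) (b : Bool) :
    f (boolSign R b) = boolSign S b := by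
  cases b <;> simp [boolSign]

theorem boolSign_injective {K : Type*} [Field K] (h2 : (2 : K) ≠ 0) :
    Function.Injective (boolSign K) := by
  have h : (-1 : K) ≠ 1 := fun h => h2 (by linear_combination -h)
  intro a b hab
  cases a <;> cases b <;> simp [boolSign, h, h.symm] at hab ⊢

variable {N k : Type*} [Field N] [Field k] {T : Subring (N × k)} {H : Fin 12 → Fin 12 → Bool}

theorem boolSign_mem (b : Bool) : (boolSign N b, boolSign k b) ∈ T := by
  cases b
  · exact T.one_mem
  · exact T.neg_mem T.one_mem

theorem IsPlaceGraph.sign_relation (hT : IsPlaceGraph T) (h2 : (2 : k) ≠ 0)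
    {z : Fin 12 → Fin 12 → N} {z' : Fin 12 → Fin 12 → k} (hz : ∀ i j, (z i j, z' i j) ∈ T)
    (hz' : ∀ i j, z' i j ≠ 0) {x y : Fin 12 → N} (hsq : ∀ i j, z i j ^ 2 = x i * y j)
    (hH : ∀ i j, z' i j * z' 0 0 = boolSign k (H i j) * (z' i 0 * z' 0 j)) (i j : Fin 12) :
    z i j * z 0 0 = boolSign N (H i j) * (z i 0 * z 0 j) := by
  have h : (z i j * z 0 0) ^ 2 = (boolSign N (H i j) * (z i 0 * z 0 j)) ^ 2 := by
    rw [mul_pow _ (z i 0 * z 0 j), boolSign_sq]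
    simp only [mul_pow, hsq]
    ring
  rcases sq_eq_sq_iff_eq_or_eq_neg.1 h with h | h
  · exact h
  · exfalso
    have h1 := T.mul_mem (hz i j) (hz 0 0)
    have h3 := T.neg_mem (T.mul_mem (boolSign_mem (H i j)) (T.mul_mem (hz i 0) (hz 0 j)))
    simp only [Prod.mk_mul_mk, Prod.neg_mk] at h1 h3
    rw [h] at h1
    have h4 := hT.unique h1 h3
    rw [← hH] at h4
    have h5 : 2 * (z' i j * z' 0 0) = 0 := by linear_combination h4
    exact mul_ne_zero h2 (mul_ne_zero (hz' i j) (hz' 0 0)) h5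

theorem sign_equivariant (h2 : (2 : N) ≠ 0) {z : Fin 12 → Fin 12 → N} (hz : ∀ i j, z i j ≠ 0)
    (hH : ∀ i j, z i j * z 0 0 = boolSign N (H i j) * (z i 0 * z 0 j)) {σ : N →+* N}
    {π ρ : Fin 12 → Fin 12} (hσ : ∀ i j, σ (z i j) = z (π i) (ρ j)) (hπ : π 0 = 0)
    (i j : Fin 12) : H (π i) (ρ j) = (H i j ^^ H (π i) (ρ 0)) := by
  apply boolSign_injective h2
  rw [← boolSign_mul]
  have h := congrArg σ (hH i j)
  simp only [map_mul, map_boolSign, hσ, hπ] at h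
  have e1 := hH (π i) (ρ j)
  have e2 := hH (π i) (ρ 0)
  refine mul_right_cancel₀ (mul_ne_zero (mul_ne_zero (hz (π i) 0) (hz 0 (ρ j)))
    (mul_ne_zero (hz 0 (ρ 0)) (hz 0 0))) ?_
  linear_combination z 0 0 ^ 2 * h - z 0 0 * z 0 (ρ 0) * e1 +
    boolSign N (H i j) * z 0 (ρ j) * z 0 0 * e2

theorem map_pairNum {S : Type*} [CommRing S] (f : R →+* S) (u x y b : R) :
    f (pairNum u x y b) = pairNum (f u) (f x) (f y) (f b) := by
  simp only [pairNum, map_add, map_sub, map_mul, map_pow, map_neg, map_ofNat, map_zero]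

theorem map_pairDen {S : Type*} [CommRing S] (f : R →+* S) (u x y b : R) :
    f (pairDen u x y b) = pairDen (f u) (f x) (f y) (f b) := by
  simp only [pairDen, map_add, map_sub, map_mul, map_pow, map_neg, map_ofNat]

theorem pairNum_mem {u x y b : N} {u' x' y' b' : k} (hu : (u, u') ∈ T) (hx : (x, x') ∈ T)
    (hy : (y, y') ∈ T) (hb : (b, b') ∈ T) : (pairNum u x y b, pairNum u' x' y' b') ∈ T := by
  have h := (pairNum (⟨_, hu⟩ : T) ⟨_, hx⟩ ⟨_, hy⟩ ⟨_, hb⟩).2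
  have e : ((pairNum (⟨_, hu⟩ : T) ⟨_, hx⟩ ⟨_, hy⟩ ⟨_, hb⟩ : T) : N × k) =
      (pairNum u x y b, pairNum u' x' y' b') :=
    Prod.ext (map_pairNum ((RingHom.fst N k).comp T.subtype) _ _ _ _)
      (map_pairNum ((RingHom.snd N k).comp T.subtype) _ _ _ _)
  rwa [e] at h

theorem pairDen_mem {u x y b : N} {u' x' y' b' : k} (hu : (u, u') ∈ T) (hx : (x, x') ∈ T)
    (hy : (y, y') ∈ T) (hb : (b, b') ∈ T) : (pairDen u x y b, pairDen u' x' y' b') ∈ T := by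
  have h := (pairDen (⟨_, hu⟩ : T) ⟨_, hx⟩ ⟨_, hy⟩ ⟨_, hb⟩).2
  have e : ((pairDen (⟨_, hu⟩ : T) ⟨_, hx⟩ ⟨_, hy⟩ ⟨_, hb⟩ : T) : N × k) =
      (pairDen u x y b, pairDen u' x' y' b') :=
    Prod.ext (map_pairDen ((RingHom.fst N k).comp T.subtype) _ _ _ _)
      (map_pairDen ((RingHom.snd N k).comp T.subtype) _ _ _ _)
  rwa [e] at h

theorem quarticP_mem {u x : N} {u' x' : k} (hu : (u, u') ∈ T) (hx : (x, x') ∈ T) :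
    (quarticP u x, quarticP u' x') ∈ T := by
  have h := (quarticP (⟨_, hu⟩ : T) ⟨_, hx⟩).2
  have e : ((quarticP (⟨_, hu⟩ : T) ⟨_, hx⟩ : T) : N × k) = (quarticP u x, quarticP u' x') :=
    Prod.ext (map_quarticP ((RingHom.fst N k).comp T.subtype) _ _)
      (map_quarticP ((RingHom.snd N k).comp T.subtype) _ _)
  rwa [e] at h

end Signs

section SignData

/-- Roots of `f_D` modulo `3463` for `√-11 = 1135` and `t = 3412`. -/
def residueA : Fin 12 → ℤ :=
  ![446, 676, 823, 905, 1089, 1879, 2093, 2306, 2338, 2653, 2779, 2907]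

/-- Roots of the conjugate of `f_D` modulo `3463` for `√-11 = 1135` and `t = 3412`. -/
def residueB : Fin 12 → ℤ :=
  ![549, 886, 962, 1118, 1217, 1305, 1729, 1730, 2226, 2737, 2858, 3345]

/-- Values of `pairNum` at the residues. -/
def residueNum (i j : Fin 12) : ℤ :=
  pairNum 1135 (quarticP 1135 (residueA i)) (quarticP (-1135) (residueB j)) (residueB j)

/-- Values of `pairDen` at the residues. -/
def residueDen (i j : Fin 12) : ℤ :=
  pairDen 1135 (quarticP 1135 (residueA i)) (quarticP (-1135) (residueB j)) (residueB j)

theorem residue_sign (i j : Fin 12) :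
    (residueNum i j * residueNum 0 0 * (residueDen i 0 * residueDen 0 j)) % 3463 =
      (boolSign ℤ (hadamard12 i j) * (residueNum i 0 * residueNum 0 j) *
        (residueDen i j * residueDen 0 0)) % 3463 := by
  revert i j
  decide +kernel

theorem residue_ne (i j : Fin 12) :
    residueNum i j % 3463 ≠ 0 ∧ residueDen i j % 3463 ≠ 0 := by
  revert i j
  decide +kernel

theorem residue_root (i : Fin 12) : evalL (polyFL 3463 1135 3412) (residueA i) % 3463 = 0 ∧
    evalL (polyFL 3463 (-1135) 3412) (residueB i) % 3463 = 0 := by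
  revert i
  decide +kernel

theorem residue_injective (i j : Fin 12) :
    ((residueA i - residueA j) % 3463 = 0 → i = j) ∧
      ((residueB i - residueB j) % 3463 = 0 → i = j) := by
  revert i j
  decide +kernel

end SignData

section Reindexing

variable {N k : Type*} [Field N] [Field k] {T : Subring (N × k)} {R : Type*} [CommRing R]
  [Algebra R N]

theorem IsPlaceGraph.exists_reindex [CharP k 3463] (hT : IsPlaceGraph T)
    (hT_int : ∀ x : N, IsIntegral R x → ∃ y, (x, y) ∈ T) {u : N} {t : R} {u₀ t₀ : ℤ}
    (hu : (u, (u₀ : k)) ∈ T) (ht : (algebraMap R N t, (t₀ : k)) ∈ T) (hu' : u ^ 2 = -11)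
    (hlead : leadF (u₀ : k) ≠ 0) (hleadN : leadF u ≠ 0) {α : Fin 12 → N}
    (hα : polyF u (algebraMap R N t) = C (leadF u) * ∏ i, (X - C (α i))) {A : Fin 12 → ℤ}
    (hA : ∀ i, evalL (polyFL 3463 u₀ t₀) (A i) % 3463 = 0)
    (hinj : ∀ i j, (A i - A j) % 3463 = 0 → i = j) :
    ∃ e : Equiv.Perm (Fin 12), ∀ i, (α (e i), (A i : k)) ∈ T := by
  have hzero : ∀ n : ℤ, (n : k) = 0 ↔ n % 3463 = 0 := by
    intro n
    rw [CharP.intCast_eq_zero_iff k 3463, Nat.cast_ofNat, Int.dvd_iff_emod_eq_zero]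
  have hr : ∀ i, ∃ y, (α i, y) ∈ T := fun i => hT.exists_root_image hT_int hu hlead hu'
    ((eval_polyF_eq_zero_iff hleadN hα).2 ⟨i, rfl⟩)
  choose r hr using hr
  have hprod := hT.polyF_eq_prod hu ht hα hr
  have h : ∀ i, ∃ j, (A i : k) = r j := by
    intro i
    rw [← eval_polyF_eq_zero_iff hlead hprod, eval_polyF, ← evalL_polyFL (p := 3463)]
    have h1 := (hzero _).2 (hA i)
    have h2 := map_evalL (Int.castRingHom k) (polyFL 3463 u₀ t₀) (A i)
    simp only [Int.coe_castRingHom] at h2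
    rw [h2] at h1
    exact h1
  choose f hf using h
  have hfinj : Function.Injective f := by
    intro i j hij
    apply hinj
    rw [← hzero]
    push_cast
    rw [hf, hf, hij, sub_self]
  refine ⟨Equiv.ofBijective f (Finite.injective_iff_bijective.1 hfinj), fun i => ?_⟩
  rw [hf]
  exact hr _

end Reindexing

section Stabilizer

theorem leadF_ne_zero {K : Type*} [Field K] [CharZero K] {u : K} (hu : u ≠ 0) : leadF u ≠ 0 := by
  unfold leadF
  exact mul_ne_zero (by norm_num) hu

theorem leadF_intCast_ne_zero {k : Type*} [Field k] {p : ℕ} [CharP k p] {u₀ : ℤ}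
    (h : ¬ (p : ℤ) ∣ leadF u₀) : leadF (u₀ : k) ≠ 0 := by
  intro h1
  apply h
  rw [← CharP.intCast_eq_zero_iff k p, ← h1]
  simp only [leadF]
  norm_num

theorem root_pair_relation {N : Type*} [Field N] [CharZero N] {u t a b : N}
    (hu : u ^ 2 = -11) (ht : t ≠ 0)
    (ha : (polyF u t).eval a = 0) (hb : (polyF (-u) t).eval b = 0) :
    354294 * a * quarticP (-u) b ^ 3 = (349805 - 16951 * u) * quarticP u a ^ 3 * b := by
  have hu0 : u ≠ 0 := by
    rintro rfl
    norm_num at hu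
  rw [eval_polyF] at ha hb
  have h : 11 ^ 2 * u * (2 ^ 8 * 3 ^ 13) * t * ((253 * u - 67) * a * quarticP (-u) b ^ 3 -
      (253 * u + 67) * quarticP u a ^ 3 * b) = 0 := by
    linear_combination 2 ^ 8 * 3 ^ 13 * (253 * u + 67) * t * b * ha +
      2 ^ 8 * 3 ^ 13 * (253 * u - 67) * t * a * hb
  have h1 := (mul_eq_zero.1 h).resolve_left
    (mul_ne_zero (mul_ne_zero (mul_ne_zero (by norm_num) hu0) (by norm_num)) ht)
  have h2 : (2 : N) * (354294 * a * quarticP (-u) b ^ 3 -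
      (349805 - 16951 * u) * quarticP u a ^ 3 * b) = 0 := by
    linear_combination (-253 * u - 67) * h1 + (253 ^ 2 * a * quarticP (-u) b ^ 3
      - 253 ^ 2 * quarticP u a ^ 3 * b) * hu
  exact sub_eq_zero.1 ((mul_eq_zero.1 h2).resolve_left two_ne_zero)

variable {F N : Type} [Field F] [Field N] [CharZero N] [Algebra F N] [FiniteDimensional F N]
  [IsGalois F N] [Algebra ℤ[X] F] [IsFractionRing ℤ[X] F] [Algebra ℤ[X] N]
  [IsScalarTower ℤ[X] F N]

variable (F) in
theorem exists_sign_functions {u : N} (hu : u ^ 2 = -11) {τ : N ≃ₐ[F] N} (hτ : τ u = -u)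
    {α β : Fin 12 → N}
    (hα : polyF u (algebraMap ℤ[X] N X) = C (leadF u) * ∏ i, (X - C (α i)))
    (hβ : polyF (-u) (algebraMap ℤ[X] N X) = C (leadF (-u)) * ∏ i, (X - C (β i))) :
    ∃ e e' : Equiv.Perm (Fin 12), Function.Injective α ∧
      (∀ i j, pairNum u (quarticP u (α i)) (quarticP (-u) (β j)) (β j) /
        pairDen u (quarticP u (α i)) (quarticP (-u) (β j)) (β j) ≠ 0) ∧
      ∀ z : Fin 12 → Fin 12 → N,
        (∀ i j, z i j = pairNum u (quarticP u (α (e i))) (quarticP (-u) (β (e' j))) (β (e' j)) /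
          pairDen u (quarticP u (α (e i))) (quarticP (-u) (β (e' j))) (β (e' j))) →
        ∀ i j, z i j * z 0 0 = boolSign N (hadamard12 i j) * (z i 0 * z 0 j) := by
  have hp : Nat.Prime 3463 := by norm_num
  have hu0 : u ≠ 0 := by
    rintro rfl
    norm_num at hu
  have ht : algebraMap ℤ[X] N X ≠ 0 := by
    rw [IsScalarTower.algebraMap_apply ℤ[X] F N]
    simp
  obtain ⟨k, hk, hkp, T, φ, hT, hTu, hTt, hT_int, -, -⟩ := exists_specialization (R := ℤ[X]) (F := F)
    hp (by norm_num) hu hτ (u₀ := 1135) (t₀ := 3412) (by decide +kernel) (by decide +kernel)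
    (eval₂RingHom (Int.castRingHom (ZMod 3463)) 3412) (t := X) (by simp)
  have hTu' : (-u, (((-1135 : ℤ)) : k)) ∈ T := by
    have := T.neg_mem hTu
    rw [Prod.neg_mk] at this
    exact_mod_cast this
  have hzero : ∀ n : ℤ, (n : k) = 0 ↔ n % 3463 = 0 := by
    intro n
    rw [CharP.intCast_eq_zero_iff k 3463, Nat.cast_ofNat, Int.dvd_iff_emod_eq_zero]
  have h2 : (2 : k) ≠ 0 := by
    intro h
    have := (hzero 2).1 (by exact_mod_cast h)
    norm_num at this
  obtain ⟨e, he⟩ := hT.exists_reindex hT_int hTu hTt hu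
    (leadF_intCast_ne_zero (p := 3463) (by decide +kernel)) (leadF_ne_zero hu0) hα
    (fun i => (residue_root i).1) (fun i j => (residue_injective i j).1)
  obtain ⟨e', he'⟩ := hT.exists_reindex hT_int hTu' hTt (by rw [neg_sq, hu])
    (leadF_intCast_ne_zero (p := 3463) (by decide +kernel)) (leadF_ne_zero (neg_ne_zero.2 hu0)) hβ
    (fun i => (residue_root i).2) (fun i j => (residue_injective i j).2)
  have hnum : ∀ i j, (pairNum u (quarticP u (α (e i))) (quarticP (-u) (β (e' j))) (β (e' j)),
      (residueNum i j : k)) ∈ T := by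
    intro i j
    have h := pairNum_mem hTu (quarticP_mem hTu (he i)) (quarticP_mem hTu' (he' j)) (he' j)
    have e1 := map_pairNum (Int.castRingHom k) 1135 (quarticP 1135 (residueA i))
      (quarticP (-1135) (residueB j)) (residueB j)
    rw [map_quarticP, map_quarticP] at e1
    simp only [Int.coe_castRingHom] at e1
    rw [residueNum, e1]
    exact h
  have hden : ∀ i j, (pairDen u (quarticP u (α (e i))) (quarticP (-u) (β (e' j))) (β (e' j)),
      (residueDen i j : k)) ∈ T := by
    intro i j
    have h := pairDen_mem hTu (quarticP_mem hTu (he i)) (quarticP_mem hTu' (he' j)) (he' j)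
    have e1 := map_pairDen (Int.castRingHom k) 1135 (quarticP 1135 (residueA i))
      (quarticP (-1135) (residueB j)) (residueB j)
    rw [map_quarticP, map_quarticP] at e1
    simp only [Int.coe_castRingHom] at e1
    rw [residueDen, e1]
    exact h
  have hnum0 : ∀ i j, (residueNum i j : k) ≠ 0 := fun i j h => (residue_ne i j).1 ((hzero _).1 h)
  have hden0 : ∀ i j, (residueDen i j : k) ≠ 0 := fun i j h => (residue_ne i j).2 ((hzero _).1 h)
  have hne : ∀ {x : N} {y : k}, (x, y) ∈ T → y ≠ 0 → x ≠ 0 := by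
    rintro x y h hy rfl
    exact hy (hT.eq_zero _ h)
  refine ⟨e, e', ?_, ?_, ?_⟩
  · intro i j hij
    obtain ⟨i, rfl⟩ := e.surjective i
    obtain ⟨j, rfl⟩ := e.surjective j
    have h1 := he i
    rw [hij] at h1
    have h3 := hT.unique h1 (he j)
    rw [← sub_eq_zero, ← Int.cast_sub, hzero] at h3
    rw [(residue_injective i j).1 h3]
  · intro i j
    obtain ⟨i, rfl⟩ := e.surjective i
    obtain ⟨j, rfl⟩ := e'.surjective j
    exact div_ne_zero (hne (hnum i j) (hnum0 i j)) (hne (hden i j) (hden0 i j))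
  · intro z hz
    refine hT.sign_relation h2 (z' := fun i j => (residueNum i j : k) * (residueDen i j : k)⁻¹)
      (x := fun i => quarticP u (α (e i))) (y := fun j => quarticP (-u) (β (e' j))) ?_ ?_ ?_ ?_
    · intro i j
      rw [hz, div_eq_mul_inv]
      exact T.mul_mem (hnum i j) (hT.inv_mem _ _ (hden i j) (hden0 i j))
    · intro i j
      exact mul_ne_zero (hnum0 i j) (inv_ne_zero (hden0 i j))
    · intro i j
      rw [hz, div_pow, div_eq_iff (pow_ne_zero 2 (hne (hden i j) (hden0 i j)))]
      exact pairNum_sq hu (root_pair_relation hu ht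
        ((eval_polyF_eq_zero_iff (leadF_ne_zero hu0) hα).2 ⟨_, rfl⟩)
        ((eval_polyF_eq_zero_iff (leadF_ne_zero (neg_ne_zero.2 hu0)) hβ).2 ⟨_, rfl⟩))
    · intro i j
      have h3 := (hzero _).2 (Int.emod_eq_emod_iff_emod_sub_eq_zero.1 (residue_sign i j))
      push_cast at h3
      have h4 : ((boolSign ℤ (hadamard12 i j) : ℤ) : k) = boolSign k (hadamard12 i j) :=
        map_boolSign (Int.castRingHom k) _
      rw [h4] at h3
      have d1 := hden0 i j
      have d2 := hden0 0 0
      have d3 := hden0 i 0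
      have d4 := hden0 0 j
      field_simp
      linear_combination h3

end Stabilizer

section Order

variable {F N : Type} [Field F] [Field N] [CharZero N] [Algebra F N] [FiniteDimensional F N]
  [IsGalois F N] [Algebra ℤ[X] F] [IsFractionRing ℤ[X] F] [Algebra ℤ[X] N]
  [IsScalarTower ℤ[X] F N]

theorem exists_frobenius_perm {u : N} (hu : u ^ 2 = -11) {τ : N ≃ₐ[F] N} (hτ : τ u = -u)
    {α : Fin 12 → N}
    (hα : polyF u (algebraMap ℤ[X] N X) = C (leadF u) * ∏ i, (X - C (α i)))
    {Φ : MulAction.stabilizer (N ≃ₐ[F] N) u →* Equiv.Perm (Fin 12)}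
    (hΦ : ∀ σ i, α (Φ σ i) = (σ : N ≃ₐ[F] N) (α i)) {t₀ : ℤ} {R a b : List ℤ}
    (hsep : eqL 23 (addL 23 (mulL 23 a (polyFL 23 9 t₀))
      (mulL 23 b (derivL 23 (polyFL 23 9 t₀)))) [1] = true)
    (hR : eqL 23 (smulL 23 4 (polyFL 23 9 t₀)) (addL 23 [0, 0, 0, 0, 0, 0, 0, 0, 0, 0, 0, 0, 1]
      (smulL 23 (-1) R)) = true) :
    ∃ π ∈ Φ.range, (∀ m, eqL 23 (frobL 23 R m) [0, 1] = true → π ^ m = 1) ∧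
      ∀ (m c : ℕ) {h g U q : List ℤ}, h.length = c → h.length + g.length = 12 →
        eqL 23 (mulL 23 (h ++ [1]) (g ++ [1])) (addL 23 [0, 0, 0, 0, 0, 0, 0, 0, 0, 0, 0, 0, 1]
          (smulL 23 (-1) R)) = true →
        eqL 23 (mulModL 23 R U (addL 23 (frobL 23 R m) [0, -1])) (h ++ [1]) = true →
        eqL 23 (mulModL 23 R q (h ++ [1])) (addL 23 (frobL 23 R m) [0, -1]) = true →
        (fixedFinset (π ^ m)).card = c := by
  classical
  have hp : Nat.Prime 23 := by norm_num
  have hu0 : u ≠ 0 := by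
    rintro rfl
    norm_num at hu
  obtain ⟨k, hk, hkp, T, φ, hT, hTu, hTt, hT_int, hφ, hφu⟩ := exists_specialization (R := ℤ[X])
    (F := F) hp (by norm_num) hu hτ (u₀ := 9) (t₀ := t₀) (by decide +kernel) (by decide +kernel)
    (eval₂RingHom (Int.castRingHom (ZMod 23)) t₀) (t := X) (by simp)
  have hlead : leadF ((9 : ℤ) : k) ≠ 0 := leadF_intCast_ne_zero (p := 23) (by decide +kernel)
  have hr : ∀ i, ∃ y, (α i, y) ∈ T := fun i => hT.exists_root_image hT_int hTu hlead hu
    ((eval_polyF_eq_zero_iff (leadF_ne_zero hu0) hα).2 ⟨i, rfl⟩)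
  choose r hr using hr
  have hprod := hT.polyF_eq_prod hTu hTt hα hr
  have hrinj : Function.Injective r := by
    refine injective_of_separable ?_ hprod
    rw [← evalL_polyFL_X (p := 23)]
    exact separable_evalL (p := 23) hsep
  have hrR : ∀ i, r i ^ 12 = evalL R (r i) := by
    intro i
    have h1 := evalL_eq_of_eqL (p := 23) hR (r i)
    have h2 := (eval_polyF_eq_zero_iff hlead hprod).2 ⟨i, rfl⟩
    rw [eval_polyF, ← evalL_polyFL (p := 23)] at h2
    have h3 := evalL_smulL (p := 23) 4 (polyFL 23 9 t₀) (r i)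
    have h4 := evalL_addL (p := 23) [0, 0, 0, 0, 0, 0, 0, 0, 0, 0, 0, 0, 1]
      (smulL 23 (-1) R) (r i)
    have h5 := evalL_smulL (p := 23) (-1) R (r i)
    have h6 : evalL [0, 0, 0, 0, 0, 0, 0, 0, 0, 0, 0, 0, 1] (r i) = r i ^ 12 := by
      simp only [evalL_cons, evalL_nil]
      push_cast
      ring
    push_cast at h2 h3 h4 h5
    rw [h6] at h4
    linear_combination -h1 + h3 - h4 - h5 + 4 * h2
  let φ' : MulAction.stabilizer (N ≃ₐ[F] N) u := ⟨φ, hφu⟩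
  have hpow := frobenius_pow hT hr hφ (fun i => hΦ φ' i)
  refine ⟨Φ φ', ⟨φ', rfl⟩, ?_, ?_⟩
  · intro m hm
    ext i
    congr 1
    apply hrinj
    rw [hpow, ← evalL_frobL hp (hrR i)]
    have := evalL_eq_of_eqL (p := 23) hm (r i)
    refine this.trans ?_
    simp
  · rintro m c h g U q rfl hlen hfac hU hq
    rw [← card_frobenius_fixed hp hrinj hrR m hlen hfac hU hq]
    congr 1
    ext i
    rw [mem_fixedFinset, Finset.mem_filter, ← hpow, hrinj.eq_iff]
    simp

set_option maxHeartbeats 1000000 in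
theorem card_range_permHom {u : N} (hu : u ^ 2 = -11) {τ : N ≃ₐ[F] N} (hτ : τ u = -u)
    {α : Fin 12 → N}
    (hα : polyF u (algebraMap ℤ[X] N X) = C (leadF u) * ∏ i, (X - C (α i)))
    {Φ : MulAction.stabilizer (N ≃ₐ[F] N) u →* Equiv.Perm (Fin 12)}
    (hΦ : ∀ σ i, α (Φ σ i) = (σ : N ≃ₐ[F] N) (α i)) (hle : Nat.card Φ.range ≤ 95040) :
    Nat.card Φ.range = 95040 := by
  obtain ⟨g11, m11, p11, f11⟩ := exists_frobenius_perm hu hτ hα hΦ (t₀ := 2)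
    (R := [5, 9, 0, 20, 9, 4, 6, 11, 18, 20, 2, 15])
    (a := [0, 0, 18, 20, 1, 20, 3, 11, 22, 12, 2])
    (b := [20, 0, 10, 11, 14, 5, 12, 21, 19, 12, 4, 19])
    (by decide +kernel) (by decide +kernel)
  obtain ⟨g10, m10, p10, f10⟩ := exists_frobenius_perm hu hτ hα hΦ (t₀ := 8)
    (R := [5, 17, 0, 20, 9, 4, 6, 11, 18, 20, 2, 15])
    (a := [0, 0, 22, 4, 14, 4, 19, 16, 9, 7, 5])
    (b := [16, 0, 2, 16, 12, 1, 7, 18, 13, 7, 10, 13])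
    (by decide +kernel) (by decide +kernel)
  obtain ⟨g8, m8, p8, f8⟩ := exists_frobenius_perm hu hτ hα hΦ (t₀ := 13)
    (R := [5, 16, 0, 20, 9, 4, 6, 11, 18, 20, 2, 15])
    (a := [0, 0, 2, 15, 18, 15, 8, 14, 5, 9, 13])
    (b := [17, 0, 19, 14, 22, 21, 9, 10, 20, 9, 3, 20])
    (by decide +kernel) (by decide +kernel)
  obtain ⟨g6, m6, p6, f6⟩ := exists_frobenius_perm hu hτ hα hΦ (t₀ := 6)
    (R := [5, 22, 0, 20, 9, 4, 6, 11, 18, 20, 2, 15])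
    (a := [0, 0, 15, 9, 20, 9, 14, 13, 3, 10, 17])
    (b := [4, 0, 16, 13, 4, 8, 10, 6, 12, 10, 11, 12])
    (by decide +kernel) (by decide +kernel)
  have c11_1 := f11 1 1 (h := [10]) (g := [11, 21, 14, 15, 16, 21, 18, 4, 7, 18, 21])
    (U := [14, 8, 15, 0, 18, 0, 10, 21, 7, 18, 4]) (q := [19, 21, 6, 12, 22, 19, 9, 13, 18, 15, 12])
    rfl rfl (by decide +kernel) (by decide +kernel) (by decide +kernel)
  have c10_1 := f10 1 0 (h := []) (g := [18, 6, 0, 3, 14, 19, 17, 12, 5, 3, 21, 8])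
    (U := [4, 12, 12, 6, 0, 6, 6, 13, 22, 10, 4, 21])
    (q := [0, 2, 3, 4, 18, 7, 16, 8, 6, 0, 12, 22])
    rfl rfl (by decide +kernel) (by decide +kernel) (by decide +kernel)
  have c10_2 := f10 2 2 (h := [22, 16]) (g := [5, 5, 16, 5, 13, 10, 18, 10, 12, 15])
    (U := [20, 19, 15, 4, 16, 20, 0, 3, 10]) (q := [6, 12, 18, 18, 21, 12, 3, 18, 3, 16])
    rfl rfl (by decide +kernel) (by decide +kernel) (by decide +kernel)
  have c8_1 := f8 1 2 (h := [22, 21]) (g := [5, 6, 16, 17, 14, 16, 11, 5, 19, 10])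
    (U := [19, 16, 13, 10, 14, 8, 15, 14, 19, 14]) (q := [5, 4, 13, 22, 22, 0, 3, 7, 20, 15])
    rfl rfl (by decide +kernel) (by decide +kernel) (by decide +kernel)
  have c8_2 := f8 2 4 (h := [6, 20, 9, 13]) (g := [3, 18, 16, 21, 3, 16, 8, 18])
    (U := [14, 14, 9, 21, 2, 13, 6, 4]) (q := [12, 13, 21, 4, 17, 6, 18, 15])
    rfl rfl (by decide +kernel) (by decide +kernel) (by decide +kernel)
  have c8_4 := f8 4 4 (h := [6, 20, 9, 13]) (g := [3, 18, 16, 21, 3, 16, 8, 18])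
    (U := [2, 6, 7, 0, 4, 11, 10, 7]) (q := [14, 18, 12, 3, 17, 18, 20, 10])
    rfl rfl (by decide +kernel) (by decide +kernel) (by decide +kernel)
  have c6_2 := f6 2 3 (h := [21, 1, 21]) (g := [14, 18, 18, 8, 11, 20, 6, 17, 10])
    (U := [3, 11, 5, 5, 14, 17, 7, 22, 11]) (q := [10, 3, 13, 12, 12, 21, 17, 7, 17])
    rfl rfl (by decide +kernel) (by decide +kernel) (by decide +kernel)
  rw [pow_one] at c11_1 c10_1 c8_1
  exact card_eq_of_cycles (Fintype.card_fin 12) hle m11 (p11 11 (by decide +kernel)) c11_1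
    m10 (p10 10 (by decide +kernel)) c10_1 c10_2 m8 (p8 8 (by decide +kernel)) c8_1 c8_2 c8_4
    m6 (p6 6 (by decide +kernel)) c6_2

theorem card_stabilizer_sqrt {u : N} (hu : u ^ 2 = -11) {τ : N ≃ₐ[F] N} (hτ : τ u = -u)
    {α β : Fin 12 → N}
    (hα : polyF u (algebraMap ℤ[X] N X) = C (leadF u) * ∏ i, (X - C (α i)))
    (hβ : polyF (-u) (algebraMap ℤ[X] N X) = C (leadF (-u)) * ∏ i, (X - C (β i)))
    (hgen : ∀ σ : N ≃ₐ[F] N, (∀ i, σ (α i) = α i) → (∀ i, σ (β i) = β i) → σ = 1) :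
    Nat.card (MulAction.stabilizer (N ≃ₐ[F] N) u) = 95040 := by
  classical
  have hu0 : u ≠ 0 := by
    rintro rfl
    norm_num at hu
  have ht : ∀ σ : N ≃ₐ[F] N, σ (algebraMap ℤ[X] N X) = algebraMap ℤ[X] N X := by
    intro σ
    rw [IsScalarTower.algebraMap_apply ℤ[X] F N, AlgEquiv.commutes]
  obtain ⟨e, e', hinj, hz0, hz⟩ := exists_sign_functions F hu hτ hα hβ
  obtain ⟨Φ, hΦ⟩ := exists_permHom (leadF_ne_zero hu0) hα hinj ht
  have hrigid : ∀ σ : MulAction.stabilizer (N ≃ₐ[F] N) u,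
      (∀ i : Fin 12, i.val < 5 → Φ σ (e i) = e i) → σ = 1 := by
    intro σ hσ
    have hσu : (σ : N ≃ₐ[F] N) u = u := MulAction.mem_stabilizer_iff.1 σ.2
    have hσu'' : ((σ : N ≃ₐ[F] N) : N →+* N) u = u := hσu
    have hσu' : (σ : N ≃ₐ[F] N) (-u) = -u := by rw [map_neg, hσu]
    have h := exists_apply_root (leadF_ne_zero (neg_ne_zero.2 hu0)) hβ hσu' (ht _)
    choose f hf using h
    let z : Fin 12 → Fin 12 → N := fun i j =>
      pairNum u (quarticP u (α (e i))) (quarticP (-u) (β (e' j))) (β (e' j)) /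
        pairDen u (quarticP u (α (e i))) (quarticP (-u) (β (e' j))) (β (e' j))
    have hσP : ∀ v x, ((σ : N ≃ₐ[F] N) : N →+* N) (quarticP v x) =
        quarticP ((σ : N ≃ₐ[F] N) v) ((σ : N ≃ₐ[F] N) x) := fun v x =>
      map_quarticP ((σ : N ≃ₐ[F] N) : N →+* N) v x
    have key := sign_equivariant two_ne_zero (z := z) (fun i j => hz0 _ _)
      (hz z fun i j => rfl) (σ := ((σ : N ≃ₐ[F] N) : N →+* N))
      (π := fun i => e.symm (Φ σ (e i))) (ρ := fun j => e'.symm (f (e' j))) (by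
        intro i j
        simp only [z, Equiv.apply_symm_apply, hΦ, ← hf]
        rw [map_div₀, map_pairNum, map_pairDen, hσP, hσP, hσu', hσu, hσu'']
        rfl) (by simp [hσ 0 (by norm_num)])
    have hr := hadamard12_rigid (fun i hi => by simp [hσ i hi]) key
    apply Subtype.ext
    apply hgen
    · intro i
      have := hr.1 (e.symm i)
      simp only [Equiv.apply_symm_apply, EmbeddingLike.apply_eq_iff_eq] at this
      rw [← hΦ, this]
    · intro j
      have := hr.2 (e'.symm j)
      simp only [Equiv.apply_symm_apply, EmbeddingLike.apply_eq_iff_eq] at this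
      rw [hf, this]
  have hΦinj : Function.Injective Φ := by
    rw [injective_iff_map_eq_one]
    intro σ hσ
    exact hrigid σ fun i _ => by rw [hσ]; rfl
  rw [← Nat.card_congr (MonoidHom.ofInjective hΦinj).toEquiv.symm]
  have hle : Nat.card Φ.range ≤ 95040 := by
    have h1 := card_le_of_pointwise_stabilizer
      (G := Φ.range.map (MulAut.conj e.symm).toMonoidHom) (by
        rintro g ⟨_, ⟨σ, rfl⟩, rfl⟩ hg
        have : σ = 1 := hrigid σ fun i hi => by
          have := hg i hi
          exact (Equiv.symm_apply_eq e).1 this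
        rw [this, map_one, map_one])
    rwa [Nat.card_congr (Φ.range.equivMapOfInjective
      (f := (MulAut.conj e.symm).toMonoidHom) (MulAut.conj e.symm).injective).toEquiv]
  exact card_range_permHom hu hτ hα hΦ hle

end Order

section Norm

variable {R : Type*} [CommRing R]

/-- The rational part of `polyF`. -/
noncomputable def polyRat (t : R) : R[X] :=
  1331 * (3 * (594 * X ^ 4 - 7920 * X ^ 2 - 1474 * X + 135) ^ 2 *
      (1188 * X ^ 3 + 198 * X ^ 2 - 1346 * X - 27) -
    11 * (1188 * X ^ 3 + 198 * X ^ 2 - 1346 * X - 27) ^ 3) + 67 * 2 ^ 8 * 3 ^ 13 * C t * X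

/-- The coefficient of `√-11` in `polyF`. -/
noncomputable def polyIrr (t : R) : R[X] :=
  -121 * ((594 * X ^ 4 - 7920 * X ^ 2 - 1474 * X + 135) ^ 3 -
    33 * (594 * X ^ 4 - 7920 * X ^ 2 - 1474 * X + 135) *
      (1188 * X ^ 3 + 198 * X ^ 2 - 1346 * X - 27) ^ 2) - 253 * 2 ^ 8 * 3 ^ 13 * C t * X

/-- The norm of `polyF`, that is, the polynomial `f_{D2}`. -/
noncomputable def polyNorm (t : R) : R[X] := polyRat t ^ 2 + 11 * polyIrr t ^ 2

theorem map_polyNorm {S : Type*} [CommRing S] (f : R →+* S) (t : R) :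
    (polyNorm t).map f = polyNorm (f t) := by
  simp [polyNorm, polyRat, polyIrr]

theorem polyF_eq_add {u : R} (hu : u ^ 2 = -11) (t : R) :
    polyF u t = polyRat t + C u * polyIrr t := by
  have h : (C u : R[X]) ^ 2 = -11 := by
    rw [← C_pow, hu, C_neg, C_ofNat]
  simp only [polyF, quarticP, polyRat, polyIrr]
  linear_combination (-121 * (3 * (594 * X ^ 4 - 7920 * X ^ 2 - 1474 * X + 135) ^ 2 *
    (1188 * X ^ 3 + 198 * X ^ 2 - 1346 * X - 27) + 3 * C u *
    (594 * X ^ 4 - 7920 * X ^ 2 - 1474 * X + 135) *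
      (1188 * X ^ 3 + 198 * X ^ 2 - 1346 * X - 27) ^ 2 + (C u ^ 2 - 11) *
      (1188 * X ^ 3 + 198 * X ^ 2 - 1346 * X - 27) ^ 3)) * h

theorem polyNorm_eq_mul {u : R} (hu : u ^ 2 = -11) (t : R) :
    polyNorm t = polyF u t * polyF (-u) t := by
  have h : (C u : R[X]) ^ 2 = -11 := by
    rw [← C_pow, hu, C_neg, C_ofNat]
  rw [polyF_eq_add hu, polyF_eq_add (by rw [neg_sq, hu]), C_neg, polyNorm]
  linear_combination polyIrr t ^ 2 * h

end Norm

section Splitting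

theorem polyF_ne_zero {N : Type*} [Field N] [CharZero N] {u : N} (hu : u ^ 2 = -11) (t : N) :
    polyF u t ≠ 0 := by
  have hu0 : u ≠ 0 := by
    rintro rfl
    norm_num at hu
  intro h
  have := (natDegree_polyF (leadF_ne_zero hu0) t).1
  rw [h] at this
  simp at this

theorem Multiset.exists_eq_map_univ {A : Type*} {m : Multiset A} {n : ℕ} (h : m.card = n) :
    ∃ f : Fin n → A, m = Finset.univ.val.map f := by
  induction m using Quotient.inductionOn with
  | h l =>
    subst h
    exact ⟨l.get, ((Fin.univ_val_map l.get).trans (congrArg _ (List.ofFn_get l))).symm⟩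

theorem exists_roots_polyF {N : Type*} [Field N] [CharZero N] {u t : N} (hu : u ^ 2 = -11)
    (h : (polyF u t).Splits) :
    ∃ α : Fin 12 → N, polyF u t = C (leadF u) * ∏ i, (X - C (α i)) ∧ ∑ i, α i = -(6 * u) := by
  have hu0 : u ≠ 0 := by
    rintro rfl
    norm_num at hu
  have hl := leadF_ne_zero hu0
  obtain ⟨h1, h2, h3⟩ := natDegree_polyF hl t
  obtain ⟨α, hα⟩ := Multiset.exists_eq_map_univ (h.natDegree_eq_card_roots.symm.trans h1)
  refine ⟨α, ?_, ?_⟩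
  · have h4 := h.eq_prod_roots
    rwa [h2, hα, Multiset.map_map] at h4
  · have h4 := h.nextCoeff_eq_neg_sum_roots_mul_leadingCoeff
    rw [nextCoeff_of_natDegree_pos (by rw [h1]; norm_num), h1, h2, h3, hα] at h4
    change _ = -leadF u * ∑ i, α i at h4
    apply mul_left_cancel₀ hl
    linear_combination h4

theorem exists_sqrt_of_splits {N : Type*} [Field N] [CharZero N] {t : N}
    (h : (polyNorm t).Splits) : ∃ u : N, u ^ 2 = -11 := by
  obtain ⟨w, hw⟩ := IsAlgClosed.exists_pow_nat_eq (-11 : AlgebraicClosure N) two_pos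
  let f := algebraMap N (AlgebraicClosure N)
  obtain ⟨α, hα, hsum⟩ := exists_roots_polyF (t := f t) hw (IsAlgClosed.splits _)
  have hr : ∀ i, ∃ a, f a = α i := by
    intro i
    have h0 : polyNorm t ≠ 0 := by
      intro h0
      have h1 := map_polyNorm f t
      rw [h0, Polynomial.map_zero, polyNorm_eq_mul hw] at h1
      exact mul_ne_zero (polyF_ne_zero hw _) (polyF_ne_zero (by rw [neg_sq, hw]) _) h1.symm
    have h2 : (polyNorm (f t)).eval (α i) = 0 := by
      rw [polyNorm_eq_mul hw, hα, eval_mul, eval_mul, eval_prod,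
        Finset.prod_eq_zero (Finset.mem_univ i) (by simp)]
      simp
    rw [← map_polyNorm] at h2
    exact h.mem_range_of_isRoot h0 h2
  choose a ha using hr
  refine ⟨-(∑ i, a i) / 6, f.injective ?_⟩
  have h6 : f (-(∑ i, a i) / 6) = w := by
    rw [map_div₀, map_neg, map_sum, Finset.sum_congr rfl fun i _ => ha i, hsum, map_ofNat]
    ring
  rw [map_pow, h6, hw, map_neg, map_ofNat]

theorem sq_ne_neg_eleven {F : Type*} [Field F] [Algebra ℤ[X] F] [IsFractionRing ℤ[X] F] (x : F) :
    x ^ 2 ≠ -11 := by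
  intro hx
  have hi : IsIntegral ℤ[X] x := by
    refine ⟨X ^ 2 + C 11, monic_X_pow_add_C _ two_ne_zero, ?_⟩
    rw [eval₂_add, eval₂_pow, eval₂_X, eval₂_C, hx, map_ofNat, neg_add_cancel]
  obtain ⟨p, rfl⟩ := IsIntegrallyClosed.isIntegral_iff.1 hi
  have hp : p ^ 2 = -11 := by
    apply IsFractionRing.injective ℤ[X] F
    rw [map_pow, hx, map_neg, map_ofNat]
  have := congrArg (eval 0) hp
  simp at this
  nlinarith [sq_nonneg (eval 0 p)]

end Splitting

section GaloisGroup

variable {F N : Type} [Field F] [Field N] [CharZero F] [Algebra F N] [Algebra ℤ[X] F]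
  [IsFractionRing ℤ[X] F] [Algebra ℤ[X] N] [IsScalarTower ℤ[X] F N]

variable (F N) in
theorem card_algEquiv_of_isSplittingField
    [IsSplittingField F N (polyNorm (algebraMap ℤ[X] F X))] :
    Nat.card (N ≃ₐ[F] N) = 190080 := by
  have : CharZero N := charZero_of_injective_algebraMap (algebraMap F N).injective
  have : FiniteDimensional F N :=
    IsSplittingField.finiteDimensional N (polyNorm (algebraMap ℤ[X] F X))
  have : Normal F N := Normal.of_isSplittingField (polyNorm (algebraMap ℤ[X] F X))
  have : IsGalois F N := ⟨⟩
  set t := algebraMap ℤ[X] N X with ht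
  have hmap : (polyNorm (algebraMap ℤ[X] F X)).map (algebraMap F N) = polyNorm t := by
    rw [map_polyNorm, ← IsScalarTower.algebraMap_apply]
  have hsplit : (polyNorm t).Splits := hmap ▸
    IsSplittingField.splits N (polyNorm (algebraMap ℤ[X] F X))
  obtain ⟨u, hu⟩ := exists_sqrt_of_splits hsplit
  have hu' : (-u) ^ 2 = -11 := by rw [neg_sq, hu]
  have hu0 : u ≠ 0 := by
    rintro rfl
    norm_num at hu
  have hne : polyNorm t ≠ 0 := by
    rw [polyNorm_eq_mul hu]
    exact mul_ne_zero (polyF_ne_zero hu _) (polyF_ne_zero hu' _)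
  have hmul := polyNorm_eq_mul hu t
  obtain ⟨α, hα, -⟩ := exists_roots_polyF hu (hsplit.of_dvd hne ⟨_, hmul⟩)
  obtain ⟨β, hβ, -⟩ := exists_roots_polyF hu' (hsplit.of_dvd hne ⟨_, hmul.trans (mul_comm _ _)⟩)
  have hgen : ∀ σ : N ≃ₐ[F] N, (∀ i, σ (α i) = α i) → (∀ i, σ (β i) = β i) → σ = 1 := by
    intro σ h1 h2
    apply AlgEquiv.coe_toAlgHom_injective
    refine AlgHom.ext_of_adjoin_eq_top
      (IsSplittingField.adjoin_rootSet N (polyNorm (algebraMap ℤ[X] F X))) ?_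
    intro x hx
    have hx := (mem_rootSet.1 hx).2
    rw [aeval_def, ← eval_map, hmap, hmul, eval_mul, mul_eq_zero,
      eval_polyF_eq_zero_iff (leadF_ne_zero hu0) hα,
      eval_polyF_eq_zero_iff (leadF_ne_zero (neg_ne_zero.2 hu0)) hβ] at hx
    rcases hx with ⟨i, rfl⟩ | ⟨i, rfl⟩
    · exact h1 i
    · exact h2 i
  have hsq : ∀ σ : N ≃ₐ[F] N, σ u = u ∨ σ u = -u := by
    intro σ
    rw [← sq_eq_sq_iff_eq_or_eq_neg, ← map_pow, hu, map_neg, map_ofNat]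
  obtain ⟨τ, hτ⟩ : ∃ τ : N ≃ₐ[F] N, τ u = -u := by
    by_contra! h
    obtain ⟨x, hx⟩ := IntermediateField.mem_bot.1 ((IsGalois.mem_bot_iff_fixed u).2
      fun σ => (hsq σ).resolve_right (h σ))
    refine sq_ne_neg_eleven x ((algebraMap F N).injective ?_)
    rw [map_pow, hx, hu, map_neg, map_ofNat]
  have horb : MulAction.orbit (N ≃ₐ[F] N) u = {u, -u} := by
    ext x
    rw [MulAction.mem_orbit_iff, Set.mem_insert_iff, Set.mem_singleton_iff]
    constructor
    · rintro ⟨σ, rfl⟩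
      exact hsq σ
    · rintro (rfl | rfl)
      · exact ⟨1, one_smul _ _⟩
      · exact ⟨τ, hτ⟩
  have hne' : u ≠ -u := fun h => hu0 (self_eq_neg.1 h)
  rw [← Subgroup.index_mul_card (MulAction.stabilizer (N ≃ₐ[F] N) u), MulAction.index_stabilizer,
    horb, Set.ncard_pair hne', card_stabilizer_sqrt hu hτ hα hβ hgen]

theorem card_gal_polyNorm : Nat.card (polyNorm (algebraMap ℤ[X] F X)).Gal = 190080 :=
  card_algEquiv_of_isSplittingField F (polyNorm (algebraMap ℤ[X] F X)).SplittingField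

end GaloisGroup

section RationalFunctions

theorem isFractionRing_of_isFractionRing_rat {F : Type*} [Field F] [Algebra ℚ[X] F]
    [IsFractionRing ℚ[X] F] [Algebra ℤ[X] F]
    (h : ∀ p : ℤ[X], algebraMap ℤ[X] F p = algebraMap ℚ[X] F (p.map (Int.castRingHom ℚ))) :
    IsFractionRing ℤ[X] F := by
  have hinj : Function.Injective (algebraMap ℤ[X] F) := by
    intro p q hpq
    rw [h, h] at hpq
    exact map_injective _ Int.cast_injective (IsFractionRing.injective ℚ[X] F hpq)
  have : FaithfulSMul ℤ[X] F := (faithfulSMul_iff_algebraMap_injective _ _).2 hinj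
  have hnum : ∀ p : ℚ[X], ∃ (n : ℤ) (q : ℤ[X]), n ≠ 0 ∧
      q.map (Int.castRingHom ℚ) = C (n : ℚ) * p := by
    intro p
    obtain ⟨n, hn, hp⟩ := IsLocalization.integerNormalization_spec (nonZeroDivisors ℤ) p
    refine ⟨n, _, nonZeroDivisors.ne_zero hn, hp.trans ?_⟩
    rw [← smul_eq_C_mul, Int.cast_smul_eq_zsmul]
  refine IsFractionRing.of_field _ _ fun z => ?_
  obtain ⟨p, q, hq, rfl⟩ := IsFractionRing.div_surjective (A := ℚ[X]) z
  obtain ⟨n, p', hn, hp'⟩ := hnum p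
  obtain ⟨m, q', hm, hq'⟩ := hnum q
  refine ⟨C m * p', C n * q', ?_⟩
  have hC : ∀ {n : ℤ}, n ≠ 0 → algebraMap ℚ[X] F (C (n : ℚ)) ≠ 0 := by
    intro n hn
    rw [Ne, FaithfulSMul.algebraMap_eq_zero_iff, C_eq_zero, Int.cast_eq_zero]
    exact hn
  have hq0 : algebraMap ℚ[X] F q ≠ 0 := by
    rw [Ne, FaithfulSMul.algebraMap_eq_zero_iff]
    exact nonZeroDivisors.ne_zero hq
  have h1 := hC hn
  have h2 := hC hm
  simp only [h, Polynomial.map_mul, hp', hq', map_C, Int.coe_castRingHom, map_mul]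
  field_simp

theorem card_gal_polyNorm_ratFunc : Nat.card (polyNorm (RatFunc.X : RatFunc ℚ)).Gal = 190080 := by
  let _ : Algebra ℤ[X] (RatFunc ℚ) :=
    ((algebraMap ℚ[X] (RatFunc ℚ)).comp (mapRingHom (Int.castRingHom ℚ))).toAlgebra
  have h : ∀ p : ℤ[X], algebraMap ℤ[X] (RatFunc ℚ) p =
    algebraMap ℚ[X] (RatFunc ℚ) (p.map (Int.castRingHom ℚ)) := fun p => rfl
  have : IsFractionRing ℤ[X] (RatFunc ℚ) := isFractionRing_of_isFractionRing_rat h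
  have hX : algebraMap ℤ[X] (RatFunc ℚ) X = RatFunc.X := by
    rw [h, map_X, RatFunc.algebraMap_X]
  rw [← hX]
  exact card_gal_polyNorm

theorem ratFunc_mapRingHom_algebraMap {K L : Type*} [Field K] [Field L] (f : K →+* L)
    (h : nonZeroDivisors K[X] ≤ (nonZeroDivisors L[X]).comap (mapRingHom f)) (p : K[X]) :
    RatFunc.mapRingHom (mapRingHom f) h (algebraMap K[X] (RatFunc K) p) =
      algebraMap L[X] (RatFunc L) (p.map f) := by
  rw [RatFunc.coe_mapRingHom_eq_coe_map]
  have := RatFunc.map_apply_div_ne_zero (mapRingHom f) h p 1 one_ne_zero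
  simpa using this

theorem ratFunc_mapRingHom_X {K L : Type*} [Field K] [Field L] (f : K →+* L)
    (h : nonZeroDivisors K[X] ≤ (nonZeroDivisors L[X]).comap (mapRingHom f)) :
    RatFunc.mapRingHom (mapRingHom f) h RatFunc.X = RatFunc.X := by
  rw [← RatFunc.algebraMap_X, ratFunc_mapRingHom_algebraMap, map_X, RatFunc.algebraMap_X]

theorem ratFunc_mapRingHom_C {K L : Type*} [Field K] [Field L] (f : K →+* L)
    (h : nonZeroDivisors K[X] ≤ (nonZeroDivisors L[X]).comap (mapRingHom f)) (a : K) :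
    RatFunc.mapRingHom (mapRingHom f) h (RatFunc.C a) = RatFunc.C (f a) := by
  rw [← RatFunc.algebraMap_C, ratFunc_mapRingHom_algebraMap, map_C, RatFunc.algebraMap_C]

end RationalFunctions

/-- Let `K = ℚ(√-11)`, `u = √-11`, and `σ` the nontrivial automorphism of
`K/ℚ`.  The polynomial `f_{D2} = f_D · σf_D` has coefficients in `ℚ(t)` and its Galois group
over `ℚ(t)` has order `190080`, the order of `M₁₂.2 = Aut(M₁₂)`. -/
theorem galois_group_of_fD2_has_card_M12_2 (K : Type) [Field K] [Algebra ℚ K]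
    (u : K) (hu : u ^ 2 = -11) (hgen : IntermediateField.adjoin ℚ {u} = ⊤)
    (σ : K ≃ₐ[ℚ] K) (hσ : σ u = -u) :
    -- the extension of `σ` to `K(t)` fixing `t`, used to conjugate coefficients
    let sigmaT : RatFunc K →+* RatFunc K :=
      RatFunc.mapRingHom (Polynomial.mapRingHom (σ : K →+* K))
        (nonZeroDivisors_le_comap_nonZeroDivisors_of_injective _
          (Polynomial.map_injective _ (RingHom.injective _)))
    -- the inclusion `ℚ(t) → K(t)`
    let ι : RatFunc ℚ →+* RatFunc K :=
      RatFunc.mapRingHom (Polynomial.mapRingHom (algebraMap ℚ K))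
        (nonZeroDivisors_le_comap_nonZeroDivisors_of_injective _
          (Polynomial.map_injective _ (RingHom.injective _)))
    let U : Polynomial (RatFunc K) := C (RatFunc.C u)
    let t : Polynomial (RatFunc K) := C RatFunc.X
    let fD : Polynomial (RatFunc K) :=
      -11 ^ 2 * U * (1188 * U * X ^ 3 + 198 * U * X ^ 2 - 1346 * U * X - 27 * U
          + 594 * X ^ 4 - 7920 * X ^ 2 - 1474 * X + 135) ^ 3
        - 2 ^ 8 * 3 ^ 13 * (253 * U - 67) * t * X
    let fD2 : Polynomial (RatFunc K) := fD * fD.map sigmaT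
    ∃ g : Polynomial (RatFunc ℚ), g.map ι = fD2 ∧ Nat.card g.Gal = 190080 := by
  intro sigmaT ι U t fD fD2
  refine ⟨polyNorm RatFunc.X, ?_, card_gal_polyNorm_ratFunc⟩
  have hfD : fD = polyF (RatFunc.C u) RatFunc.X := by
    simp only [fD, U, t, polyF, quarticP]
  have hι : ι RatFunc.X = RatFunc.X := by
    exact ratFunc_mapRingHom_X _ _
  have hσX : sigmaT RatFunc.X = RatFunc.X := by
    exact ratFunc_mapRingHom_X _ _
  have hσu : sigmaT (RatFunc.C u) = -RatFunc.C u := by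
    refine (ratFunc_mapRingHom_C _ _ u).trans ?_
    rw [← map_neg, ← hσ]
    rfl
  have hu' : (RatFunc.C u) ^ 2 = -11 := by
    rw [← map_pow, hu, map_neg, map_ofNat]
  rw [map_polyNorm, hι, polyNorm_eq_mul hu']
  simp only [fD2]
  rw [hfD, map_polyF, hσX, hσu]
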